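/- Let f be a multiplicative arithmetic function satisfying 0 ≤ f(p^r) ≤ c₁·c₂^r for all primes p and all r ≥ 1, where c₁ ≥ 1 and 1 ≤ c₂ < 2 are constants, and suppose that ∑_{p ≤ x, p prime} f(p) = τ·Li(x) + O(x·(log x)^{-2-ρ}) for fixed real numbers τ > 0 and ρ > 1, and let B_f be the constant with ∑_{n ≤ x} Λ_f(n)/n = τ·log x + B_f + o(1). Then there exist ε' > 0 and constants C₁(f) > 0 and C₂(f) such that ∑_{n ≤ x} f(n) = (C₁(f)·x/(log x)^{1-τ})·(1 + C₂(f)/log x + O((log x)^{-1-ε'})) as x → ∞, and moreover C₂(f) = (1 − τ)·(1 + B_f). -/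

import Mathlib

open Filter Finset Asymptotics Topology


namespace Moree

/-- partial sums over `n ≤ e^t` -/
noncomputable def S (a : ℕ → ℝ) (t : ℝ) : ℝ := ∑ n ∈ Finset.Icc 1 ⌊Real.exp t⌋₊, a n

/-- Dirichlet convolution -/
noncomputable def cv (a b : ℕ → ℝ) (n : ℕ) : ℝ := ∑ d ∈ n.divisors, a d * b (n / d)

lemma mem_iff (n : ℕ) (t : ℝ) :
    n ∈ Finset.Icc 1 ⌊Real.exp t⌋₊ ↔ 1 ≤ n ∧ Real.log n ≤ t := by
  rw [Finset.mem_Icc, Nat.le_floor_iff (Real.exp_pos t).le]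
  refine and_congr_right fun h => ?_
  rw [Real.log_le_iff_le_exp (by exact_mod_cast h)]

lemma log_nonneg' {n : ℕ} : 0 ≤ Real.log n := Real.log_natCast_nonneg n

lemma exp_log' {n : ℕ} (h : 1 ≤ n) : Real.exp (Real.log n) = n :=
  Real.exp_log (by exact_mod_cast h)

lemma Icc_empty {t : ℝ} (ht : t < 0) : Finset.Icc 1 ⌊Real.exp t⌋₊ = ∅ := by
  ext n
  rw [mem_iff]
  simp only [Finset.notMem_empty, iff_false, not_and, not_le]
  intro _
  exact lt_of_lt_of_le ht log_nonneg'

lemma S_neg (a : ℕ → ℝ) {t : ℝ} (ht : t < 0) : S a t = 0 := by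
  rw [S, Icc_empty ht, Finset.sum_empty]

lemma Icc_sub {s t : ℝ} (h : s ≤ t) :
    Finset.Icc 1 ⌊Real.exp s⌋₊ ⊆ Finset.Icc 1 ⌊Real.exp t⌋₊ := by
  intro n hn
  rw [mem_iff] at *
  exact ⟨hn.1, hn.2.trans h⟩

lemma S_mono {a : ℕ → ℝ} (ha : ∀ n, 0 ≤ a n) {s t : ℝ} (h : s ≤ t) : S a s ≤ S a t :=
  Finset.sum_le_sum_of_subset_of_nonneg (Icc_sub h) (fun n _ _ => ha n)

lemma S_nonneg {a : ℕ → ℝ} (ha : ∀ n, 0 ≤ a n) (t : ℝ) : 0 ≤ S a t :=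
  Finset.sum_nonneg (fun n _ => ha n)

lemma S_congr {a b : ℕ → ℝ} (h : ∀ n, 1 ≤ n → a n = b n) (t : ℝ) : S a t = S b t :=
  Finset.sum_congr rfl (fun n hn => h n (Finset.mem_Icc.1 hn).1)

/-- Abel type sums -/
noncomputable def W (a : ℕ → ℝ) (φ : ℝ → ℝ) (t : ℝ) : ℝ :=
  ∑ n ∈ Finset.Icc 1 ⌊Real.exp t⌋₊, a n * (φ t - φ (Real.log n))

lemma W_eq (a : ℕ → ℝ) (φ : ℝ → ℝ) (t : ℝ) :
    W a φ t = S a t * φ t - S (fun n => a n * φ (Real.log n)) t := by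
  rw [W, S, S, Finset.sum_mul, ← Finset.sum_sub_distrib]
  exact Finset.sum_congr rfl (fun n _ => by ring)

lemma W_continuous (a : ℕ → ℝ) {φ : ℝ → ℝ} (hφ : Continuous φ) : Continuous (W a φ) := by
  rw [continuous_iff_continuousAt]
  intro t₀
  have h1 : ContinuousAt (fun t => ∑ n ∈ Finset.Icc 1 ⌊Real.exp (t₀ + 1)⌋₊,
      a n * (φ (max t (Real.log n)) - φ (Real.log n))) t₀ := by
    apply Continuous.continuousAt
    fun_prop
  refine h1.congr ?_
  filter_upwards [Iio_mem_nhds (show t₀ < t₀ + 1 by linarith)] with t ht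
  symm
  rw [W]
  have h2 : ∑ n ∈ Finset.Icc 1 ⌊Real.exp t⌋₊, a n * (φ t - φ (Real.log n)) =
    ∑ n ∈ Finset.Icc 1 ⌊Real.exp t⌋₊, a n * (φ (max t (Real.log n)) - φ (Real.log n)) := by
    refine Finset.sum_congr rfl (fun n hn => ?_)
    rw [max_eq_left ((mem_iff n t).1 hn).2]
  rw [h2]
  refine Finset.sum_subset (Icc_sub (le_of_lt ht)) (fun n hn hn' => ?_)
  have : t ≤ Real.log n := by
    by_contra h
    exact hn' ((mem_iff n t).2 ⟨(Finset.mem_Icc.1 hn).1, (not_le.1 h).le⟩)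
  rw [max_eq_right this]; ring

lemma W_deriv (a : ℕ → ℝ) {φ : ℝ → ℝ} {φ' : ℝ} {t : ℝ} (hφ : HasDerivAt φ φ' t) :
    HasDerivWithinAt (W a φ) (S a t * φ') (Set.Ici t) t := by
  have h1 : HasDerivWithinAt (fun s => ∑ n ∈ Finset.Icc 1 ⌊Real.exp t⌋₊,
      a n * (φ s - φ (Real.log n))) (S a t * φ') (Set.Ici t) t := by
    rw [S, Finset.sum_mul]
    apply HasDerivWithinAt.fun_sum
    intro n _
    exact ((hφ.hasDerivWithinAt).sub_const _).const_mul _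
  refine h1.congr_of_eventuallyEq ?_ rfl
  have h2 : ∀ᶠ s in 𝓝[≥] t, Real.exp s < ⌊Real.exp t⌋₊ + 1 := by
    apply nhdsWithin_le_nhds
    exact (Real.continuous_exp.continuousAt.eventually_lt continuousAt_const
      (Nat.lt_floor_add_one _))
  filter_upwards [h2, self_mem_nhdsWithin] with s hs hs'
  have : ⌊Real.exp s⌋₊ = ⌊Real.exp t⌋₊ := by
    rw [Nat.floor_eq_iff (Real.exp_pos s).le]
    exact ⟨(Nat.floor_le (Real.exp_pos t).le).trans (Real.exp_le_exp.2 hs'), hs⟩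
  rw [W, this]

lemma cv_comm (a b : ℕ → ℝ) (n : ℕ) : cv a b n = cv b a n := by
  rw [cv, cv, ← Nat.sum_divisorsAntidiagonal (fun i j => a i * b j),
    Nat.sum_divisorsAntidiagonal' (fun i j => a i * b j)]
  exact Finset.sum_congr rfl (fun _ _ => mul_comm _ _)

lemma S_cv (a b : ℕ → ℝ) (t : ℝ) :
    S (cv a b) t = ∑ d ∈ Finset.Icc 1 ⌊Real.exp t⌋₊, a d * S b (t - Real.log d) := by
  let A : ArithmeticFunction ℝ := ⟨fun n => if n = 0 then 0 else a n, by simp⟩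
  let B : ArithmeticFunction ℝ := ⟨fun n => if n = 0 then 0 else b n, by simp⟩
  have hA : ∀ n, 1 ≤ n → A n = a n := fun n hn => by
    show (if n = 0 then 0 else a n) = a n
    rw [if_neg (by omega)]
  have hB : ∀ n, 1 ≤ n → B n = b n := fun n hn => by
    show (if n = 0 then 0 else b n) = b n
    rw [if_neg (by omega)]
  have key := ArithmeticFunction.sum_Ioc_mul_eq_sum_sum A B ⌊Real.exp t⌋₊
  have hI : ∀ N : ℕ, Finset.Ioc 0 N = Finset.Icc 1 N := fun N => by ext; simp [Nat.succ_le_iff]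
  simp only [hI] at key
  rw [S]
  trans (∑ n ∈ Finset.Icc 1 ⌊Real.exp t⌋₊, (A * B) n)
  · refine Finset.sum_congr rfl (fun n hn => ?_)
    rw [cv, ArithmeticFunction.mul_apply, Nat.sum_divisorsAntidiagonal (fun i j => A i * B j)]
    refine Finset.sum_congr rfl (fun d hd => ?_)
    have hd' := Nat.dvd_of_mem_divisors hd
    have hn1 : 0 < n := (Finset.mem_Icc.1 hn).1
    rw [hA d (Nat.pos_of_mem_divisors hd), hB (n/d) (Nat.div_pos (Nat.le_of_dvd hn1 hd') (Nat.pos_of_mem_divisors hd))]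
  · rw [key]
    refine Finset.sum_congr rfl (fun d hd => ?_)
    have hd1 : 1 ≤ d := (Finset.mem_Icc.1 hd).1
    rw [hA d hd1, S, Real.exp_sub, exp_log' hd1, Nat.floor_div_natCast]
    congr 1
    exact Finset.sum_congr rfl (fun n hn => hB n (Finset.mem_Icc.1 hn).1)

lemma S_hyp (a b : ℕ → ℝ) {t v : ℝ} (hv : 0 ≤ v) (hvt : v ≤ t) :
    S (cv a b) t = ∑ n ∈ Finset.Icc 1 ⌊Real.exp v⌋₊, b n * S a (t - Real.log n)
      + ∑ d ∈ Finset.Icc 1 ⌊Real.exp (t - v)⌋₊, a d * (S b (t - Real.log d) - S b v) := by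
  let b1 : ℕ → ℝ := fun n => if Real.log n ≤ v then b n else 0
  let b2 : ℕ → ℝ := fun n => if Real.log n ≤ v then 0 else b n
  have h0 : ∀ n, cv a b n = cv b1 a n + cv a b2 n := by
    intro n
    rw [cv_comm b1 a, cv, cv, cv, ← Finset.sum_add_distrib]
    refine Finset.sum_congr rfl (fun d _ => ?_)
    simp only [b1, b2]
    split_ifs <;> ring
  have h1 : S (cv a b) t = S (cv b1 a) t + S (cv a b2) t := by
    rw [S, S, S, ← Finset.sum_add_distrib]
    exact Finset.sum_congr rfl (fun n _ => h0 n)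
  rw [h1, S_cv, S_cv]
  congr 1
  · symm
    trans (∑ n ∈ Finset.Icc 1 ⌊Real.exp v⌋₊, b1 n * S a (t - Real.log n))
    · refine Finset.sum_congr rfl (fun n hn => ?_)
      simp only [b1]
      rw [if_pos ((mem_iff n v).1 hn).2]
    · refine Finset.sum_subset (Icc_sub hvt) (fun n hn hn' => ?_)
      have : ¬ Real.log n ≤ v := fun h => hn' ((mem_iff n v).2 ⟨(Finset.mem_Icc.1 hn).1, h⟩)
      simp only [b1]
      rw [if_neg this, zero_mul]
  · symm
    have hb2 : ∀ s, v ≤ s → S b2 s = S b s - S b v := by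
      intro s hs
      have e1 : S b s = S b1 s + S b2 s := by
        rw [S, S, S, ← Finset.sum_add_distrib]
        refine Finset.sum_congr rfl (fun n _ => ?_)
        simp only [b1, b2]
        split_ifs <;> ring
      have e2 : S b v = S b1 s := by
        trans S b1 v
        · refine Finset.sum_congr rfl (fun n hn => ?_)
          simp only [b1]
          rw [if_pos ((mem_iff n v).1 hn).2]
        · refine Finset.sum_subset (Icc_sub hs) (fun n hn hn' => ?_)
          have : ¬ Real.log n ≤ v := fun h => hn' ((mem_iff n v).2 ⟨(Finset.mem_Icc.1 hn).1, h⟩)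
          simp only [b1]
          rw [if_neg this]
      rw [e1, e2]; ring
    have hb2' : ∀ s, s ≤ v → S b2 s = 0 := by
      intro s hs
      refine Finset.sum_eq_zero (fun n hn => ?_)
      simp only [b2]
      rw [if_pos (((mem_iff n s).1 hn).2.trans hs)]
    trans (∑ d ∈ Finset.Icc 1 ⌊Real.exp (t - v)⌋₊, a d * S b2 (t - Real.log d))
    · refine Finset.sum_congr rfl (fun n hn => ?_)
      rw [hb2]
      have := ((mem_iff n _).1 hn).2
      linarith
    · refine Finset.sum_subset (Icc_sub (by linarith)) (fun n hn hn' => ?_)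
      rw [hb2', mul_zero]
      by_contra h
      exact hn' ((mem_iff n _).2 ⟨(Finset.mem_Icc.1 hn).1, by linarith⟩)

end Moree


namespace Moree

lemma mono_of_rd {F F' : ℝ → ℝ} {a : ℝ} (hc : ContinuousOn F (Set.Ici a))
    (hd : ∀ t ≥ a, HasDerivWithinAt F (F' t) (Set.Ici t) t) (h : ∀ t ≥ a, 0 ≤ F' t) :
    ∀ t ≥ a, F a ≤ F t := by
  intro t ht
  have := image_le_of_deriv_right_le_deriv_boundary (f := fun _ => F a) (f' := fun _ => 0)
    (a := a) (b := t) continuousOn_const (fun x _ => hasDerivWithinAt_const _ _ _)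
    (B := F) (B' := F') le_rfl (hc.mono (fun x hx => hx.1))
    (fun x hx => hd x hx.1) (fun x hx => h x hx.1)
  exact this ⟨ht, le_rfl⟩

lemma cmp_rd {F F' Bd Bd' : ℝ → ℝ} {a : ℝ} (hc : ContinuousOn F (Set.Ici a))
    (hd : ∀ t ≥ a, HasDerivWithinAt F (F' t) (Set.Ici t) t)
    (hBd : ∀ t ≥ a, HasDerivAt Bd (Bd' t) t) (h : ∀ t ≥ a, |F' t| ≤ Bd' t)
    (h0 : |F a| ≤ Bd a) : ∀ t ≥ a, |F t| ≤ Bd t := by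
  intro t ht
  have := image_norm_le_of_norm_deriv_right_le_deriv_boundary' (f := F) (f' := F')
    (a := a) (b := t) (hc.mono (fun x hx => hx.1)) (fun x hx => hd x hx.1)
    (B := Bd) (B' := Bd') h0
    (fun x hx => (hBd x hx.1).continuousAt.continuousWithinAt)
    (fun x hx => (hBd x hx.1).hasDerivWithinAt) (fun x hx => h x hx.1)
  exact this ⟨ht, le_rfl⟩

lemma rpow_cmp {x y : ℝ} (hx : 0 < x) (hy : 0 < y) (h1 : x ≤ 2 * y) (h2 : y ≤ 2 * x) (b : ℝ) :
    x ^ b ≤ 2 ^ |b| * y ^ b := by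
  rcases le_total 0 b with hb | hb
  · rw [abs_of_nonneg hb, ← Real.mul_rpow (by norm_num) hy.le]
    exact Real.rpow_le_rpow hx.le h1 hb
  · rw [abs_of_nonpos hb]
    have : (2 * x) ^ b ≤ y ^ b := Real.rpow_le_rpow_of_nonpos hy h2 hb
    rw [Real.mul_rpow (by norm_num) hx.le] at this
    calc x ^ b = 2 ^ (-b) * (2 ^ b * x ^ b) := by
          rw [← mul_assoc, ← Real.rpow_add (by norm_num)]; simp
      _ ≤ _ := by gcongr

lemma conv_rd {F F' : ℝ → ℝ} {a b : ℝ} (hb : 0 < b) (hc : ContinuousOn F (Set.Ici a))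
    (hd : ∀ t ≥ a, HasDerivWithinAt F (F' t) (Set.Ici t) t)
    (h : F' =O[atTop] fun t => t ^ (-1 - b)) :
    ∃ L, (fun t => F t - L) =O[atTop] fun t : ℝ => t ^ (-b) := by
  obtain ⟨K, hK0, hK⟩ := h.exists_pos
  obtain ⟨a0, ha0⟩ := eventually_atTop.1 hK.bound
  set a1 := max (max a a0) 1 with ha1
  have h1a : a ≤ a1 := (le_max_left _ _).trans (le_max_left _ _)
  have h1a0 : a0 ≤ a1 := (le_max_right _ _).trans (le_max_left _ _)
  have h11 : 1 ≤ a1 := le_max_right _ _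
  have key : ∀ s ≥ a1, ∀ t ≥ s, |F t - F s| ≤ K / b * s ^ (-b) := by
    intro s hs t ht
    have hs0 : 0 < s := by linarith
    have := cmp_rd (F := fun t => F t - F s) (F' := F') (a := s)
      (Bd := fun t => K / b * s ^ (-b) - K / b * t ^ (-b))
      (Bd' := fun t => K * t ^ (-1 - b))
      ((hc.mono (Set.Ici_subset_Ici.2 (by linarith))).sub continuousOn_const)
      (fun x hx => (hd x (by linarith)).sub_const _)
      (fun x hx => by
        have hx0 : 0 < x := by linarith
        have := ((Real.hasDerivAt_rpow_const (x := x) (p := -b) (Or.inl hx0.ne')).const_mul (K / b)).const_sub (K / b * s ^ (-b))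
        refine this.congr_deriv ?_
        rw [show -b - 1 = -1 - b by ring]
        field_simp)
      (fun x hx => by
        have hx0 : 0 < x := by linarith
        have := ha0 x (by linarith)
        rwa [Real.norm_eq_abs, Real.norm_eq_abs, abs_of_pos (Real.rpow_pos_of_pos hx0 _)] at this)
      (by simp) t ht
    refine this.trans ?_
    have : 0 ≤ K / b * t ^ (-b) := by
      have : 0 ≤ t := by linarith
      positivity
    linarith
  have hC : CauchySeq (fun t => F (max t a1)) := by
    refine cauchySeq_of_le_tendsto_0 (fun N => 2 * (K / b * (max N a1) ^ (-b))) ?_ ?_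
    · intro n m N hn hm
      have hN : a1 ≤ max N a1 := le_max_right _ _
      have e1 := key (max N a1) hN (max n a1) (max_le_max_right _ hn)
      have e2 := key (max N a1) hN (max m a1) (max_le_max_right _ hm)
      rw [Real.dist_eq]
      have e3 : F (max n a1) - F (max m a1) =
        (F (max n a1) - F (max N a1)) - (F (max m a1) - F (max N a1)) := by ring
      rw [e3]
      refine (abs_sub _ _).trans ?_
      linarith
    · have t1 : Tendsto (fun N : ℝ => max N a1) atTop atTop :=
        tendsto_atTop_mono (fun N => le_max_left _ _) tendsto_id
      have t2 := ((tendsto_rpow_neg_atTop hb).comp t1).const_mul (K / b) |>.const_mul 2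
      simpa using t2
  obtain ⟨L, hL⟩ := cauchySeq_tendsto_of_complete hC
  refine ⟨L, IsBigO.of_bound (K / b) ?_⟩
  filter_upwards [eventually_ge_atTop a1] with s hs
  have hs0 : 0 < s := by linarith
  rw [Real.norm_eq_abs, Real.norm_eq_abs, abs_of_pos (Real.rpow_pos_of_pos hs0 _)]
  have t3 : Tendsto (fun t => |F (max t a1) - F s|) atTop (𝓝 |L - F s|) :=
    (hL.sub_const _).abs
  rw [abs_sub_comm]
  refine le_of_tendsto t3 ?_
  filter_upwards [eventually_ge_atTop s] with t ht
  rw [max_eq_left (by linarith)]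
  exact key s hs t ht

lemma exp_rd {F F' : ℝ → ℝ} {a b : ℝ} (hc : ContinuousOn F (Set.Ici a))
    (hd : ∀ t ≥ a, HasDerivWithinAt F (F' t) (Set.Ici t) t)
    (h : F' =O[atTop] fun t => Real.exp t * t ^ b) :
    F =O[atTop] fun t => Real.exp t * t ^ b := by
  obtain ⟨K, hK0, hK⟩ := h.exists_pos
  obtain ⟨a0, ha0⟩ := eventually_atTop.1 hK.bound
  set a1 := max (max a a0) (2 * |b| + 1) with ha1
  have h1a : a ≤ a1 := (le_max_left _ _).trans (le_max_left _ _)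
  have h1a0 : a0 ≤ a1 := (le_max_right _ _).trans (le_max_left _ _)
  have h11 : 2 * |b| + 1 ≤ a1 := le_max_right _ _
  have hpos : 0 < a1 := by have := abs_nonneg b; linarith
  have hw : ∀ t, 0 < t → 0 < Real.exp t * t ^ b := fun t ht =>
    mul_pos (Real.exp_pos _) (Real.rpow_pos_of_pos ht _)
  set K' := 2 * K + |F a1| / (Real.exp a1 * a1 ^ b) with hK'
  have hw1 := hw a1 hpos
  have hq : 0 ≤ |F a1| / (Real.exp a1 * a1 ^ b) := by positivity
  refine IsBigO.of_bound K' ?_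
  filter_upwards [eventually_ge_atTop a1] with t ht
  have ht0 : 0 < t := by linarith
  rw [Real.norm_eq_abs, Real.norm_eq_abs, abs_of_pos (hw t ht0)]
  refine cmp_rd (F := F) (F' := F') (a := a1) (Bd := fun t => K' * (Real.exp t * t ^ b))
    (Bd' := fun t => K' * (Real.exp t * t ^ b + Real.exp t * (b * t ^ (b - 1))))
    (hc.mono (Set.Ici_subset_Ici.2 h1a)) (fun x hx => hd x (by linarith)) ?_ ?_ ?_ t ht
  · intro x hx
    have hx0 : 0 < x := by linarith
    exact ((Real.hasDerivAt_exp x).mul (Real.hasDerivAt_rpow_const (x := x) (p := b) (Or.inl hx0.ne'))).const_mul K'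
  · intro x hx
    have hx0 : 0 < x := by linarith
    have e1 := ha0 x (by linarith)
    rw [Real.norm_eq_abs, Real.norm_eq_abs, abs_of_pos (hw x hx0)] at e1
    have e2 : Real.exp x * x ^ b + Real.exp x * (b * x ^ (b - 1)) =
      (Real.exp x * x ^ b) * (1 + b / x) := by
      rw [Real.rpow_sub_one hx0.ne']; field_simp
    have e3 : 1 / 2 ≤ 1 + b / x := by
      have : -(1/2) ≤ b / x := by
        rw [le_div_iff₀ hx0]
        have := neg_abs_le b
        linarith
      linarith
    rw [e2]
    refine e1.trans ?_
    have : K ≤ K' * (1 + b / x) := by nlinarith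
    calc K * (Real.exp x * x ^ b) ≤ (K' * (1 + b / x)) * (Real.exp x * x ^ b) := by
          gcongr
      _ = _ := by ring
  · rw [hK', add_mul, div_mul_cancel₀ _ hw1.ne']
    have : 0 ≤ 2 * K * (Real.exp a1 * a1 ^ b) := by positivity
    linarith

lemma ext_bd {F : ℝ → ℝ} {b : ℝ} (h : F =O[atTop] fun t => t ^ b)
    (hb : ∀ T, ∃ C, ∀ t, 0 ≤ t → t ≤ T → |F t| ≤ C) :
    ∃ K > 0, ∀ t ≥ 0, |F t| ≤ K * (1 + t) ^ b := by
  obtain ⟨K, hK0, hK⟩ := h.exists_pos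
  obtain ⟨a0, ha0⟩ := eventually_atTop.1 hK.bound
  set T := max a0 1 with hT
  obtain ⟨C, hC⟩ := hb T
  have hT1 : 1 ≤ T := le_max_right _ _
  have hC0 : 0 ≤ C := (abs_nonneg _).trans (hC 0 le_rfl (by linarith))
  refine ⟨K * 2 ^ |b| + C * (1 + T) ^ |b|, by positivity, fun t ht => ?_⟩
  have hp : 0 < (1 + t) ^ b := Real.rpow_pos_of_pos (by linarith) _
  rcases le_total t T with h1 | h1
  · have e1 := hC t ht h1
    have e2 : 1 ≤ (1 + T) ^ |b| * (1 + t) ^ b := by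
      have : (1 + t) ^ (-|b|) ≤ (1 + t) ^ b :=
        Real.rpow_le_rpow_of_exponent_le (by linarith) (neg_abs_le b)
      calc (1:ℝ) = (1 + t) ^ |b| * (1 + t) ^ (-|b|) := by
            rw [← Real.rpow_add (by linarith)]; simp
        _ ≤ _ := by gcongr
    have : 0 ≤ K * 2 ^ |b| * (1 + t) ^ b := by positivity
    nlinarith
  · have e1 := ha0 t ((le_max_left _ _).trans h1)
    have ht0 : 0 < t := by linarith
    rw [Real.norm_eq_abs, Real.norm_eq_abs, abs_of_pos (Real.rpow_pos_of_pos ht0 _)] at e1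
    have e2 := rpow_cmp ht0 (y := 1 + t) (by linarith) (by linarith) (by linarith) b
    have : 0 ≤ C * (1 + T) ^ |b| * (1 + t) ^ b := by positivity
    nlinarith

lemma tay1 (a : ℝ) : ∃ K > 0, ∀ t u : ℝ, 0 < t → |u| ≤ t / 2 →
    |(t - u) ^ a - t ^ a| ≤ K * |u| * t ^ (a - 1) := by
  refine ⟨|a| * 2 ^ |a - 1| + 1, by positivity, fun t u ht hu => ?_⟩
  have := Convex.norm_image_sub_le_of_norm_hasDerivWithin_le (f := fun x : ℝ => x ^ a)
    (f' := fun x => a * x ^ (a - 1)) (s := Set.Icc (t / 2) (2 * t))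
    (C := (|a| * 2 ^ |a - 1| + 1) * t ^ (a - 1)) (x := t) (y := t - u)
    (fun x hx => (Real.hasDerivAt_rpow_const (Or.inl (by have := hx.1; linarith))).hasDerivWithinAt)
    (fun x hx => by
      have hx0 : 0 < x := by have := hx.1; linarith
      rw [norm_mul, Real.norm_eq_abs, Real.norm_eq_abs, abs_of_pos (Real.rpow_pos_of_pos hx0 _)]
      have e := rpow_cmp hx0 ht hx.2 (by have := hx.1; linarith) (a - 1)
      have : 0 ≤ t ^ (a - 1) := by positivity
      nlinarith [mul_le_mul_of_nonneg_left e (abs_nonneg a)])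
    (convex_Icc _ _) ⟨by linarith, by linarith⟩
    (by have := abs_le.1 hu; exact ⟨by linarith, by linarith⟩)
  rw [Real.norm_eq_abs, Real.norm_eq_abs, show t - u - t = -u by ring, abs_neg] at this
  linarith

lemma tay2 (a : ℝ) : ∃ K > 0, ∀ t u : ℝ, 0 < t → |u| ≤ t / 2 →
    |(t - u) ^ a - t ^ a + a * u * t ^ (a - 1)| ≤ K * u ^ 2 * t ^ (a - 2) := by
  obtain ⟨K, hK, h⟩ := tay1 (a - 1)
  refine ⟨|a| * K + 1, by positivity, fun t u ht hu => ?_⟩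
  have := Convex.norm_image_sub_le_of_norm_hasDerivWithin_le
    (f := fun x : ℝ => x ^ a - a * t ^ (a - 1) * x)
    (f' := fun x => a * x ^ (a - 1) - a * t ^ (a - 1)) (s := Set.Icc (t - |u|) (t + |u|))
    (C := (|a| * K + 1) * |u| * t ^ (a - 2)) (x := t) (y := t - u)
    (fun x hx => by
      have hx0 : 0 < x := by have := hx.1; linarith
      have e := (Real.hasDerivAt_rpow_const (x := x) (p := a) (Or.inl hx0.ne')).sub
        ((hasDerivAt_id x).const_mul (a * t ^ (a - 1)))
      rw [mul_one] at e
      exact e.hasDerivWithinAt)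
    (fun x hx => by
      have hx1 : |t - x| ≤ |u| := by rw [abs_le]; constructor <;> linarith [hx.1, hx.2]
      have e := h t (t - x) ht (hx1.trans hu)
      rw [show t - (t - x) = x by ring, show a - 1 - 1 = a - 2 by ring] at e
      rw [← mul_sub, norm_mul, Real.norm_eq_abs, Real.norm_eq_abs]
      have hp : 0 ≤ t ^ (a - 2) := by positivity
      calc |a| * |x ^ (a - 1) - t ^ (a - 1)| ≤ |a| * (K * |u| * t ^ (a - 2)) := by
            gcongr; exact e.trans (by gcongr)
        _ ≤ _ := by nlinarith [mul_nonneg (abs_nonneg u) hp])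
    (convex_Icc _ _) ⟨by linarith [abs_nonneg u], by linarith [abs_nonneg u]⟩
    (by constructor <;> linarith [le_abs_self u, neg_abs_le u])
  rw [Real.norm_eq_abs, Real.norm_eq_abs, show t - u - t = -u by ring, abs_neg] at this
  rw [show (t - u) ^ a - t ^ a + a * u * t ^ (a - 1) =
    (t - u) ^ a - a * t ^ (a - 1) * (t - u) - (t ^ a - a * t ^ (a - 1) * t) by ring]
  refine this.trans (le_of_eq ?_)
  rw [← sq_abs u]; ring

end Moree


namespace Moree

structure Hyp (g l : ℕ → ℝ) (τ ρ B : ℝ) : Prop where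
  g0 : ∀ n, 0 ≤ g n
  l0 : ∀ n, 0 ≤ l n
  g1 : g 1 = 1
  D : ∀ n, 1 ≤ n → g n * Real.log n = cv g l n
  tau : 0 < τ
  rho : 1 < ρ
  psi : ∃ K > 0, ∀ t ≥ 0, |S l t - τ * Real.exp t| ≤ K * (Real.exp t * (1 + t) ^ (-1 - ρ))
  T : ∃ K > 0, ∀ t ≥ 0, |S (fun n => l n / n) t - τ * t - B| ≤ K * (1 + t) ^ (-ρ)

/-- logarithmic mean -/
noncomputable def mu (g : ℕ → ℝ) (t : ℝ) : ℝ := S (fun n => g n / n) t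

/-- integrated logarithmic mean -/
noncomputable def G (g : ℕ → ℝ) (t : ℝ) : ℝ := W (fun n => g n / n) (fun s => s) t

/-- error term -/
noncomputable def Er (g l : ℕ → ℝ) (τ B : ℝ) (t : ℝ) : ℝ :=
  ∑ d ∈ Finset.Icc 1 ⌊Real.exp t⌋₊, g d / d *
    (S (fun n => l n / n) (t - Real.log d) - τ * (t - Real.log d) - B)

lemma cv_div (a b : ℕ → ℝ) (n : ℕ) (hn : 1 ≤ n) :
    cv (fun n => a n / n) (fun n => b n / n) n = cv a b n / n := by
  rw [cv, cv, Finset.sum_div]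
  refine Finset.sum_congr rfl (fun d hd => ?_)
  have hd' := Nat.dvd_of_mem_divisors hd
  have hd0 : 0 < d := Nat.pos_of_mem_divisors hd
  have hd1 : (d : ℝ) ≠ 0 := by exact_mod_cast hd0.ne'
  have hn1 : (n : ℝ) ≠ 0 := by exact_mod_cast (show n ≠ 0 by omega)
  rw [Nat.cast_div hd' hd1]
  field_simp

variable {g l : ℕ → ℝ} {τ ρ B : ℝ}

lemma Hyp.gn (h : Hyp g l τ ρ B) : ∀ n : ℕ, 0 ≤ g n / n := fun n =>
  div_nonneg (h.g0 n) (Nat.cast_nonneg n)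

lemma A1 (h : Hyp g l τ ρ B) (t : ℝ) :
    (t - B) * mu g t - (τ + 1) * G g t = Er g l τ B t := by
  have e1 : G g t = mu g t * t - S (fun n => g n / n * Real.log n) t := W_eq _ _ _
  have e2 : S (fun n => g n / n * Real.log n) t =
      S (cv (fun n => g n / n) (fun n => l n / n)) t := by
    refine S_congr (fun n hn => ?_) t
    rw [cv_div _ _ n hn, ← h.D n hn]; ring
  have e3 : S (cv (fun n => g n / n) (fun n => l n / n)) t =
      τ * G g t + B * mu g t + Er g l τ B t := by
    rw [S_cv, G, W, mu, S, Er, Finset.mul_sum, Finset.mul_sum, ← Finset.sum_add_distrib,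
      ← Finset.sum_add_distrib]
    exact Finset.sum_congr rfl (fun n _ => by ring)
  rw [e2, e3] at e1
  linarith

lemma one_mem {t : ℝ} (ht : 0 ≤ t) : 1 ∈ Finset.Icc 1 ⌊Real.exp t⌋₊ := by
  rw [mem_iff]; simpa using ht

lemma mu_ge (h : Hyp g l τ ρ B) {t : ℝ} (ht : 0 ≤ t) : 1 ≤ mu g t := by
  have := Finset.single_le_sum (f := fun n : ℕ => g n / n) (fun n _ => h.gn n) (one_mem ht)
  simpa [h.g1, mu, S] using this

lemma G_ge (h : Hyp g l τ ρ B) {t : ℝ} (ht : 0 ≤ t) : t ≤ G g t := by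
  have := Finset.single_le_sum (f := fun n : ℕ => g n / n * (t - Real.log n)) (fun n hn => mul_nonneg (h.gn n) (by have := ((mem_iff n t).1 hn).2; linarith)) (one_mem ht)
  simpa [h.g1, G, W] using this

lemma Er_bd0 (h : Hyp g l τ ρ B) : ∃ K > 0, ∀ t,
    |Er g l τ B t| ≤ K * ∑ d ∈ Finset.Icc 1 ⌊Real.exp t⌋₊, g d / d * (1 + (t - Real.log d)) ^ (-ρ) := by
  obtain ⟨K, hK, hT⟩ := h.T
  refine ⟨K, hK, fun t => ?_⟩
  rw [Er, Finset.mul_sum]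
  refine (Finset.abs_sum_le_sum_abs _ _).trans (Finset.sum_le_sum (fun n hn => ?_))
  have hn2 := ((mem_iff n t).1 hn).2
  rw [abs_mul, abs_of_nonneg (h.gn n)]
  calc _ ≤ g n / n * (K * (1 + (t - Real.log n)) ^ (-ρ)) :=
        mul_le_mul_of_nonneg_left (hT _ (by linarith)) (h.gn n)
    _ = _ := by ring

lemma Er_bd1 (h : Hyp g l τ ρ B) : ∃ K > 0, ∀ t, |Er g l τ B t| ≤ K * mu g t := by
  obtain ⟨K, hK, hE⟩ := Er_bd0 h
  refine ⟨K, hK, fun t => (hE t).trans ?_⟩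
  rw [mu, S]
  gcongr with n hn
  have hn2 := ((mem_iff n t).1 hn).2
  have : (1 + (t - Real.log n)) ^ (-ρ) ≤ 1 :=
    Real.rpow_le_one_of_one_le_of_nonpos (by linarith) (by linarith [h.rho])
  exact mul_le_of_le_one_right (h.gn n) this

lemma G_cont : Continuous (G g) := W_continuous _ continuous_id

lemma G_deriv (t : ℝ) : HasDerivWithinAt (G g) (mu g t) (Set.Ici t) t := by
  have := W_deriv (fun n => g n / n) (hasDerivAt_id' t)
  rw [mul_one] at this
  exact this

lemma Gq_deriv {c t : ℝ} (ht : 0 < t - c) (τ : ℝ) :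
    HasDerivWithinAt (fun t => G g t * (t - c) ^ (-τ - 1))
      (((t - c) * mu g t - (τ + 1) * G g t) * (t - c) ^ (-τ - 2)) (Set.Ici t) t := by
  have h1 : HasDerivAt (fun t : ℝ => (t - c) ^ (-τ - 1)) (1 * (-τ - 1) * (t - c) ^ (-τ - 1 - 1)) t :=
    ((hasDerivAt_id' t).sub_const c).rpow_const (Or.inl ht.ne')
  refine ((G_deriv t).mul h1.hasDerivWithinAt).congr_deriv ?_
  have : (t - c) ^ (-τ - 1) = (t - c) * (t - c) ^ (-τ - 2) := by
    rw [show -τ - 1 = 1 + (-τ - 2) by ring, Real.rpow_add ht, Real.rpow_one]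
  rw [show -τ - 1 - 1 = -τ - 2 by ring, this]; ring

lemma Gq_cont {c a : ℝ} (ha : 0 < a - c) (τ : ℝ) :
    ContinuousOn (fun t => G g t * (t - c) ^ (-τ - 1)) (Set.Ici a) := by
  refine G_cont.continuousOn.mul (ContinuousOn.rpow_const (by fun_prop) ?_)
  intro x hx
  left
  have : a ≤ x := hx
  linarith

lemma mu_nonneg (h : Hyp g l τ ρ B) (t : ℝ) : 0 ≤ mu g t := S_nonneg h.gn t

lemma G_lower (h : Hyp g l τ ρ B) : ∃ c > 0, ∀ t ≥ 1, c * t ^ (τ + 1) ≤ G g t := by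
  obtain ⟨K, hK, hE⟩ := Er_bd1 h
  set k := |B| + K with hk
  have hk0 : 0 < k := by positivity
  have hτ := h.tau
  have := mono_of_rd (F := fun t => G g t * (t - (-k)) ^ (-τ - 1)) (a := 1)
    (Gq_cont (by linarith) τ) (fun t ht => Gq_deriv (by linarith) τ) (fun t ht => by
      have e := A1 h t
      have e2 := abs_le.1 (hE t)
      have e3 := mu_nonneg h t
      have e4 := neg_abs_le B
      refine mul_nonneg ?_ (Real.rpow_nonneg (by linarith) _)
      nlinarith)
  refine ⟨(1 + k) ^ (-τ - 1), by positivity, fun t ht => ?_⟩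
  have e1 := this t ht
  simp only [sub_neg_eq_add] at e1
  have e2 := G_ge h (show (0:ℝ) ≤ 1 by norm_num)
  have e3 : (0:ℝ) < (t + k) ^ (-τ - 1) := Real.rpow_pos_of_pos (by linarith) _
  have e4 : (t + k) ^ (-τ - 1) * (t + k) ^ (τ + 1) = 1 := by
    rw [← Real.rpow_add (by linarith)]; simp
  have e5 : t ^ (τ + 1) ≤ (t + k) ^ (τ + 1) :=
    Real.rpow_le_rpow (by linarith) (by linarith) (by linarith)
  have e6 : (0:ℝ) < (1 + k) ^ (-τ - 1) := by positivity
  have e7 : (0:ℝ) ≤ (t + k) ^ (τ + 1) := by positivity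
  calc (1 + k) ^ (-τ - 1) * t ^ (τ + 1) ≤ (1 + k) ^ (-τ - 1) * (t + k) ^ (τ + 1) := by gcongr
    _ ≤ (G g 1 * (1 + k) ^ (-τ - 1)) * (t + k) ^ (τ + 1) := by
        gcongr; nlinarith
    _ ≤ (G g t * (t + k) ^ (-τ - 1)) * (t + k) ^ (τ + 1) := by gcongr
    _ = G g t := by rw [mul_assoc, e4, mul_one]

lemma mu_upper (h : Hyp g l τ ρ B) : ∃ K > 0, ∀ t ≥ 0, mu g t ≤ K * (1 + t) ^ τ := by
  obtain ⟨K, hK, hE⟩ := Er_bd1 h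
  set k := |B| + K with hk
  have hk0 : 0 < k := by positivity
  have hτ := h.tau
  have := mono_of_rd (F := fun t => -(G g t * (t - k) ^ (-τ - 1))) (a := k + 1)
    (Gq_cont (by linarith) τ).neg (fun t ht => (Gq_deriv (by linarith) τ).neg) (fun t ht => by
      have e := A1 h t
      have e2 := abs_le.1 (hE t)
      have e3 := mu_nonneg h t
      have e4 := le_abs_self B
      rw [← neg_mul]
      refine mul_nonneg ?_ (Real.rpow_nonneg (by linarith) _)
      nlinarith)
  set g0 := G g (k + 1) with hg0
  have hg0' : 0 ≤ g0 := by have := G_ge h (show 0 ≤ k + 1 by linarith); linarith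
  refine ⟨(τ + 1) * g0 + mu g (k + 1), ?_, fun t ht => ?_⟩
  · have := mu_ge h (show 0 ≤ k + 1 by linarith)
    positivity
  · have hm := mu_nonneg h (k + 1)
    rcases le_total t (k + 1) with h1 | h1
    · have e1 : mu g t ≤ mu g (k + 1) := S_mono h.gn h1
      have e2 : 1 ≤ (1 + t) ^ τ := Real.one_le_rpow (by linarith) hτ.le
      have : 0 ≤ (τ + 1) * g0 := by positivity
      nlinarith
    · have e1 := this t h1
      simp only [show k + 1 - k = 1 by ring, Real.one_rpow, mul_one] at e1
      have hp : 0 < t - k := by linarith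
      have e4 : (t - k) ^ (-τ - 1) * (t - k) ^ (τ + 1) = 1 := by
        rw [← Real.rpow_add (by linarith)]; simp
      have e5 : G g t ≤ g0 * (t - k) ^ (τ + 1) := by
        calc G g t = (G g t * (t - k) ^ (-τ - 1)) * (t - k) ^ (τ + 1) := by
              rw [mul_assoc, e4, mul_one]
          _ ≤ g0 * (t - k) ^ (τ + 1) := by gcongr; linarith
      have e6 : (t - k) * mu g t ≤ (τ + 1) * G g t := by
        have e := A1 h t
        have e2 := abs_le.1 (hE t)
        have e3 := mu_nonneg h t
        have e4 := le_abs_self B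
        nlinarith
      have e7 : mu g t ≤ (τ + 1) * g0 * (t - k) ^ τ := by
        rw [Real.rpow_add hp, Real.rpow_one] at e5
        refine le_of_mul_le_mul_left ?_ hp
        nlinarith
      have e8 : (t - k) ^ τ ≤ (1 + t) ^ τ := Real.rpow_le_rpow hp.le (by linarith) hτ.le
      have e9 : 0 ≤ mu g (k + 1) * (1 + t) ^ τ := by positivity
      have : 0 ≤ (τ + 1) * g0 := by positivity
      nlinarith

lemma exp_sub_log (t : ℝ) {n : ℕ} (hn : 1 ≤ n) : Real.exp (t - Real.log n) = Real.exp t / n := by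
  rw [Real.exp_sub, exp_log' hn]

lemma S_upper (h : Hyp g l τ ρ B) :
    ∃ K > 0, ∀ t ≥ 0, S g t ≤ K * (Real.exp t * (1 + t) ^ (τ - 1)) := by
  obtain ⟨K1, hK1, hm⟩ := mu_upper h
  obtain ⟨K2, hK2, hpsi⟩ := h.psi
  have hτ := h.tau
  refine ⟨(K2 + τ + 2) * K1, by positivity, fun t ht => ?_⟩
  have b1 : S (fun n => g n * Real.log n) t ≤ (K2 + τ) * (Real.exp t * mu g t) := by
    rw [S_congr h.D t, S_cv, mu, S, Finset.mul_sum, Finset.mul_sum]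
    refine Finset.sum_le_sum (fun n hn => ?_)
    obtain ⟨hn1, hn2⟩ := (mem_iff n t).1 hn
    have e1 := (abs_le.1 (hpsi (t - Real.log n) (by linarith))).2
    have e2 : (1 + (t - Real.log n)) ^ (-1 - ρ) ≤ 1 :=
      Real.rpow_le_one_of_one_le_of_nonpos (by linarith) (by linarith [h.rho])
    have e3 : S l (t - Real.log n) ≤ (K2 + τ) * Real.exp (t - Real.log n) := by
      have := Real.exp_pos (t - Real.log n)
      have : K2 * (Real.exp (t - Real.log n) * (1 + (t - Real.log n)) ^ (-1 - ρ)) ≤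
        K2 * (Real.exp (t - Real.log n) * 1) := by gcongr
      linarith
    calc g n * S l (t - Real.log n) ≤ g n * ((K2 + τ) * Real.exp (t - Real.log n)) :=
          mul_le_mul_of_nonneg_left e3 (h.g0 n)
      _ = _ := by rw [exp_sub_log t hn1]; ring
  have b2 : W g (fun s => s) t ≤ Real.exp t * mu g t := by
    rw [W, mu, S, Finset.mul_sum]
    refine Finset.sum_le_sum (fun n hn => ?_)
    obtain ⟨hn1, hn2⟩ := (mem_iff n t).1 hn
    calc g n * (t - Real.log n) ≤ g n * Real.exp (t - Real.log n) :=
          mul_le_mul_of_nonneg_left (by linarith [Real.add_one_le_exp (t - Real.log n)]) (h.g0 n)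
      _ = _ := by rw [exp_sub_log t hn1]; ring
  have b3 : S g t ≤ Real.exp t * mu g t := by
    rw [mu, S, S, Finset.mul_sum]
    refine Finset.sum_le_sum (fun n hn => ?_)
    obtain ⟨hn1, hn2⟩ := (mem_iff n t).1 hn
    calc g n = g n * 1 := by ring
      _ ≤ g n * Real.exp (t - Real.log n) :=
          mul_le_mul_of_nonneg_left (by linarith [Real.add_one_le_exp (t - Real.log n)]) (h.g0 n)
      _ = _ := by rw [exp_sub_log t hn1]; ring
  rw [W_eq] at b2
  have b4 : S g t * (1 + t) ≤ (K2 + τ + 2) * (Real.exp t * mu g t) := by linarith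
  have b5 : (1 + t) ^ τ = (1 + t) ^ (τ - 1) * (1 + t) := by
    rw [Real.rpow_sub_one (by linarith)]; field_simp
  have b6 := hm t ht
  rw [b5] at b6
  refine le_of_mul_le_mul_right ?_ (show 0 < 1 + t by linarith)
  calc S g t * (1 + t) ≤ (K2 + τ + 2) * (Real.exp t * mu g t) := b4
    _ ≤ (K2 + τ + 2) * (Real.exp t * (K1 * ((1 + t) ^ (τ - 1) * (1 + t)))) := by gcongr
    _ = _ := by ring

end Moree


namespace Moree
variable {g l : ℕ → ℝ} {τ ρ B : ℝ}

lemma pow_mul_O {f f' : ℝ → ℝ} {a b c : ℝ} (h1 : f =O[atTop] fun t => t ^ a)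
    (h2 : f' =O[atTop] fun t => t ^ b) (hc : a + b = c) :
    (fun t => f t * f' t) =O[atTop] fun t : ℝ => t ^ c := by
  refine (h1.mul h2).congr' EventuallyEq.rfl ?_
  filter_upwards [eventually_gt_atTop 0] with t ht
  rw [← Real.rpow_add ht, hc]

lemma pow_le_O {a b : ℝ} (h : a ≤ b) :
    (fun t : ℝ => t ^ a) =O[atTop] fun t : ℝ => t ^ b := by
  refine IsBigO.of_bound 1 ?_
  filter_upwards [eventually_ge_atTop 1] with t ht
  have ht0 : 0 < t := by linarith
  rw [Real.norm_eq_abs, Real.norm_eq_abs, abs_of_pos (Real.rpow_pos_of_pos ht0 _),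
    abs_of_pos (Real.rpow_pos_of_pos ht0 _), one_mul]
  exact Real.rpow_le_rpow_of_exponent_le ht h

lemma wsum (h : Hyp g l τ ρ B) : ∃ K > 0, ∀ t ≥ 0,
    ∑ d ∈ Finset.Icc 1 ⌊Real.exp t⌋₊, g d / d * (1 + (t - Real.log d)) ^ (-ρ)
      ≤ K * (1 + t) ^ (τ - 1) := by
  obtain ⟨K1, hK1, hm⟩ := mu_upper h
  obtain ⟨K2, hK2, hS⟩ := S_upper h
  have hρ := h.rho
  have hsum : Summable (fun k : ℕ => (1 + (k:ℝ)) ^ (-ρ)) := by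
    have := (summable_nat_add_iff 1).2 (Real.summable_nat_rpow.2 (show -ρ < -1 by linarith))
    refine this.congr (fun k => ?_)
    push_cast; rw [add_comm]
  set Z := ∑' k : ℕ, (1 + (k:ℝ)) ^ (-ρ) with hZ
  have hZ0 : 0 ≤ Z := tsum_nonneg (fun k => by positivity)
  refine ⟨2 ^ ρ * K1 + Real.exp 1 * K2 * 2 ^ |τ - 1| * Z, by positivity, fun t ht => ?_⟩
  rw [← Finset.sum_filter_add_sum_filter_not _ (fun d : ℕ => Real.log d ≤ t / 2), add_mul]
  refine add_le_add ?_ ?_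
  · have e1 : ∀ d ∈ (Finset.Icc 1 ⌊Real.exp t⌋₊).filter (fun d : ℕ => Real.log d ≤ t / 2),
        g d / d * (1 + (t - Real.log d)) ^ (-ρ) ≤ g d / d * (2 ^ ρ * (1 + t) ^ (-1 : ℝ)) := by
      intro d hd
      have hd2 := (Finset.mem_filter.1 hd).2
      refine mul_le_mul_of_nonneg_left ?_ (h.gn d)
      calc (1 + (t - Real.log d)) ^ (-ρ) ≤ ((1 + t) / 2) ^ (-ρ) :=
            Real.rpow_le_rpow_of_nonpos (by linarith) (by linarith) (by linarith)
        _ = 2 ^ ρ * (1 + t) ^ (-ρ) := by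
            rw [Real.div_rpow (by linarith) (by norm_num), Real.rpow_neg (by norm_num : (0:ℝ) ≤ 2)]
            field_simp
        _ ≤ _ := by
            gcongr <;> linarith
    calc _ ≤ ∑ d ∈ (Finset.Icc 1 ⌊Real.exp t⌋₊).filter (fun d : ℕ => Real.log d ≤ t / 2),
              g d / d * (2 ^ ρ * (1 + t) ^ (-1 : ℝ)) := Finset.sum_le_sum e1
      _ ≤ ∑ d ∈ Finset.Icc 1 ⌊Real.exp t⌋₊, g d / d * (2 ^ ρ * (1 + t) ^ (-1 : ℝ)) := by
          refine Finset.sum_le_sum_of_subset_of_nonneg (Finset.filter_subset _ _) (fun d _ _ => ?_)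
          have := h.gn d
          positivity
      _ = mu g t * (2 ^ ρ * (1 + t) ^ (-1 : ℝ)) := by rw [mu, S, Finset.sum_mul]
      _ ≤ (K1 * (1 + t) ^ τ) * (2 ^ ρ * (1 + t) ^ (-1 : ℝ)) := by
          gcongr; exact hm t ht
      _ = _ := by
          rw [show τ - 1 = τ + (-1) by ring, Real.rpow_add (by linarith)]; ring
  · set s := (Finset.Icc 1 ⌊Real.exp t⌋₊).filter (fun d : ℕ => ¬ Real.log d ≤ t / 2) with hs
    have hs' : ∀ d ∈ s, 1 ≤ d ∧ Real.log d ≤ t ∧ t / 2 < Real.log d := by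
      intro d hd
      rw [hs, Finset.mem_filter, mem_iff, not_le] at hd
      exact ⟨hd.1.1, hd.1.2, hd.2⟩
    have hmap : ∀ d ∈ s, ⌊t - Real.log d⌋₊ ∈ Finset.range (⌊t⌋₊ + 1) := by
      intro d _
      rw [Finset.mem_range, Nat.lt_succ_iff]
      exact Nat.floor_le_floor (by linarith [log_nonneg' (n := d)])
    rw [← Finset.sum_fiberwise_of_maps_to hmap]
    have hfib : ∀ k ∈ Finset.range (⌊t⌋₊ + 1),
        ∑ d ∈ s.filter (fun d : ℕ => ⌊t - Real.log d⌋₊ = k), g d / d * (1 + (t - Real.log d)) ^ (-ρ) ≤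
        Real.exp 1 * K2 * 2 ^ |τ - 1| * (1 + t) ^ (τ - 1) * (1 + (k:ℝ)) ^ (-ρ) := by
      intro k _
      have hfl : ∀ d ∈ s.filter (fun d : ℕ => ⌊t - Real.log d⌋₊ = k),
          (k:ℝ) ≤ t - Real.log d ∧ t - Real.log d < k + 1 := by
        intro d hd
        obtain ⟨h1, h2⟩ := Finset.mem_filter.1 hd
        exact (Nat.floor_eq_iff (by linarith [(hs' d h1).2.1])).1 h2
      rcases le_or_gt ((k:ℝ)) (t / 2) with hk | hk
      · have e1 : ∀ d ∈ s.filter (fun d : ℕ => ⌊t - Real.log d⌋₊ = k),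
            g d / d * (1 + (t - Real.log d)) ^ (-ρ) ≤
              g d * (Real.exp (k + 1 - t) * (1 + (k:ℝ)) ^ (-ρ)) := by
          intro d hd
          obtain ⟨h1, h2⟩ := hfl d hd
          have hd1 := (hs' d (Finset.mem_filter.1 hd).1).1
          have i1 : ((d:ℝ))⁻¹ ≤ Real.exp (k + 1 - t) := by
            rw [← exp_log' hd1, ← Real.exp_neg]
            exact Real.exp_le_exp.2 (by linarith)
          have i2 : (1 + (t - Real.log d)) ^ (-ρ) ≤ (1 + (k:ℝ)) ^ (-ρ) :=
            Real.rpow_le_rpow_of_nonpos (by positivity) (by linarith) (by linarith)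
          rw [div_eq_mul_inv, mul_assoc]
          refine mul_le_mul_of_nonneg_left ?_ (h.g0 d)
          have : 0 ≤ (1 + (t - Real.log d)) ^ (-ρ) := Real.rpow_nonneg (by linarith [Nat.cast_nonneg (α := ℝ) k]) _
          gcongr
        have e2 : S g (t - k) ≤ K2 * (Real.exp (t - k) * (2 ^ |τ - 1| * (1 + t) ^ (τ - 1))) := by
          have hk0 := Nat.cast_nonneg (α := ℝ) k
          refine (hS (t - k) (by linarith)).trans ?_
          have := rpow_cmp (x := 1 + (t - k)) (y := 1 + t) (by linarith) (by linarith)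
            (by linarith) (by linarith) (τ - 1)
          gcongr
        calc _ ≤ ∑ d ∈ s.filter (fun d : ℕ => ⌊t - Real.log d⌋₊ = k),
                g d * (Real.exp (k + 1 - t) * (1 + (k:ℝ)) ^ (-ρ)) := Finset.sum_le_sum e1
          _ ≤ ∑ d ∈ Finset.Icc 1 ⌊Real.exp (t - k)⌋₊,
                g d * (Real.exp (k + 1 - t) * (1 + (k:ℝ)) ^ (-ρ)) := by
              refine Finset.sum_le_sum_of_subset_of_nonneg ?_ (fun d _ _ => ?_)
              · intro d hd
                rw [mem_iff]
                exact ⟨(hs' d (Finset.mem_filter.1 hd).1).1, by linarith [(hfl d hd).1]⟩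
              · have := h.g0 d
                positivity
          _ = S g (t - k) * (Real.exp (k + 1 - t) * (1 + (k:ℝ)) ^ (-ρ)) := by
              rw [S, Finset.sum_mul]
          _ ≤ (K2 * (Real.exp (t - k) * (2 ^ |τ - 1| * (1 + t) ^ (τ - 1)))) *
                (Real.exp (k + 1 - t) * (1 + (k:ℝ)) ^ (-ρ)) := by gcongr
          _ = _ := by
              have : Real.exp 1 = Real.exp (t - k) * Real.exp (k + 1 - t) := by
                rw [← Real.exp_add]; congr 1; ring
              rw [this]; ring
      · rw [Finset.filter_eq_empty_iff.2, Finset.sum_empty]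
        · positivity
        · intro d hd hdk
          have := (hfl d (Finset.mem_filter.2 ⟨hd, hdk⟩)).1
          linarith [(hs' d hd).2.2]
    refine (Finset.sum_le_sum hfib).trans ?_
    rw [← Finset.mul_sum]
    have : ∑ k ∈ Finset.range (⌊t⌋₊ + 1), (1 + (k:ℝ)) ^ (-ρ) ≤ Z :=
      hsum.sum_le_tsum _ (fun k _ => by positivity)
    calc _ ≤ Real.exp 1 * K2 * 2 ^ |τ - 1| * (1 + t) ^ (τ - 1) * Z := by gcongr
      _ = _ := by ring

lemma one_add_O (b : ℝ) : (fun t : ℝ => (1 + t) ^ b) =O[atTop] fun t : ℝ => t ^ b := by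
  refine IsBigO.of_bound (2 ^ |b|) ?_
  filter_upwards [eventually_ge_atTop 1] with t ht
  have ht0 : 0 < t := by linarith
  rw [Real.norm_eq_abs, Real.norm_eq_abs, abs_of_pos (Real.rpow_pos_of_pos ht0 _),
    abs_of_pos (Real.rpow_pos_of_pos (by linarith) _)]
  exact rpow_cmp (by linarith) ht0 (by linarith) (by linarith) b

lemma sub_O (c b : ℝ) : (fun t : ℝ => (t - c) ^ b) =O[atTop] fun t : ℝ => t ^ b := by
  refine IsBigO.of_bound (2 ^ |b|) ?_
  filter_upwards [eventually_ge_atTop (2 * |c| + 1)] with t ht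
  have h1 := le_abs_self c
  have h2 := neg_abs_le c
  have ht0 : 0 < t := by linarith [abs_nonneg c]
  rw [Real.norm_eq_abs, Real.norm_eq_abs, abs_of_pos (Real.rpow_pos_of_pos ht0 _),
    abs_of_pos (Real.rpow_pos_of_pos (by linarith) _)]
  exact rpow_cmp (by linarith) ht0 (by linarith) (by linarith) b

lemma Er_O (h : Hyp g l τ ρ B) : (Er g l τ B) =O[atTop] fun t : ℝ => t ^ (τ - 1) := by
  obtain ⟨K, hK, hE⟩ := Er_bd0 h
  obtain ⟨K', hK', hw⟩ := wsum h
  refine IsBigO.trans (IsBigO.of_bound (K * K') ?_) (one_add_O (τ - 1))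
  filter_upwards [eventually_ge_atTop 0] with t ht
  rw [Real.norm_eq_abs, Real.norm_eq_abs, abs_of_pos (Real.rpow_pos_of_pos (by linarith : 0 < 1 + t) _)]
  refine (hE t).trans ?_
  rw [mul_assoc]
  exact mul_le_mul_of_nonneg_left (hw t ht) hK.le

lemma mu_asymp (h : Hyp g l τ ρ B) : ∃ C > 0,
    (fun t => mu g t - C * (t ^ τ - τ * B * t ^ (τ - 1))) =O[atTop] fun t : ℝ => t ^ (τ - 2) := by
  have hτ := h.tau
  have hE := Er_O h
  obtain ⟨L, hL⟩ := conv_rd (F := fun t => G g t * (t - B) ^ (-τ - 1))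
    (F' := fun t => ((t - B) * mu g t - (τ + 1) * G g t) * (t - B) ^ (-τ - 2))
    (a := |B| + 1) (b := 2) (by norm_num) (Gq_cont (by linarith [le_abs_self B]) τ)
    (fun t ht => Gq_deriv (by linarith [le_abs_self B]) τ) (by
      simp only [A1 h]
      exact pow_mul_O hE (sub_O B _) (by ring))
  have hlim : Tendsto (fun t => G g t * (t - B) ^ (-τ - 1)) atTop (𝓝 L) := by
    have : Tendsto (fun t => G g t * (t - B) ^ (-τ - 1) - L) atTop (𝓝 0) :=
      hL.trans_tendsto (tendsto_rpow_neg_atTop (by norm_num))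
    simpa using this.add_const L
  have hL0 : 0 < L := by
    obtain ⟨c, hc, hG⟩ := G_lower h
    have hc' : 0 < c * (2 ^ |τ + 1|)⁻¹ := by positivity
    refine hc'.trans_le (ge_of_tendsto hlim ?_)
    filter_upwards [eventually_ge_atTop (2 * |B| + 1)] with t ht
    have h1 := le_abs_self B
    have h2 := neg_abs_le B
    have h3 := abs_nonneg B
    have hp : 0 < t - B := by linarith
    have e1 := hG t (by linarith)
    have e2 := rpow_cmp (x := t - B) (y := t) hp (by linarith) (by linarith) (by linarith) (τ + 1)
    have e4 : (t - B) ^ (τ + 1) * (t - B) ^ (-τ - 1) = 1 := by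
      rw [← Real.rpow_add (by linarith)]; simp
    calc c * (2 ^ |τ + 1|)⁻¹ = c * ((2 ^ |τ + 1|)⁻¹ * (t - B) ^ (τ + 1)) * (t - B) ^ (-τ - 1) := by
          rw [mul_assoc, mul_assoc, e4, mul_one]
      _ ≤ c * t ^ (τ + 1) * (t - B) ^ (-τ - 1) := by
          gcongr
          rw [inv_mul_le_iff₀ (by positivity)]
          exact e2
      _ ≤ _ := by gcongr
  refine ⟨(τ + 1) * L, by positivity, ?_⟩
  obtain ⟨K2, hK2, htay⟩ := tay2 τ
  have htO : (fun t => (t - B) ^ τ - t ^ τ + τ * B * t ^ (τ - 1)) =O[atTop]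
      fun t : ℝ => t ^ (τ - 2) := by
    refine IsBigO.of_bound (K2 * B ^ 2) ?_
    filter_upwards [eventually_ge_atTop (2 * |B| + 1)] with t ht
    have ht0 : 0 < t := by linarith [abs_nonneg B]
    rw [Real.norm_eq_abs, Real.norm_eq_abs, abs_of_pos (Real.rpow_pos_of_pos ht0 _)]
    exact htay t B ht0 (by linarith)
  have hm : (fun t => (τ + 1) * ((G g t * (t - B) ^ (-τ - 1) - L) * (t - B) ^ τ)
      + Er g l τ B t * (t - B) ^ (-1 : ℝ)
      + (τ + 1) * L * ((t - B) ^ τ - t ^ τ + τ * B * t ^ (τ - 1))) =O[atTop]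
      fun t : ℝ => t ^ (τ - 2) :=
    (((pow_mul_O hL (sub_O B τ) (by ring)).const_mul_left _).add
      (pow_mul_O hE (sub_O B _) (by ring))).add (htO.const_mul_left _)
  refine hm.congr' ?_ EventuallyEq.rfl
  filter_upwards [eventually_ge_atTop (|B| + 1)] with t ht
  have hp : 0 < t - B := by linarith [le_abs_self B]
  have e1 : (t - B) ^ (-τ - 1) * (t - B) ^ τ = (t - B)⁻¹ := by
    rw [← Real.rpow_add hp, ← Real.rpow_neg_one]; ring_nf
  rw [Real.rpow_neg_one, ← A1 h]
  have e2 : (G g t * (t - B) ^ (-τ - 1) - L) * (t - B) ^ τ =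
    G g t * (t - B)⁻¹ - L * (t - B) ^ τ := by rw [← e1]; ring
  rw [e2]
  field_simp
  ring

lemma exp_mul_O {f : ℝ → ℝ} {a : ℝ} (h : f =O[atTop] fun t => t ^ a) :
    (fun t => Real.exp t * f t) =O[atTop] fun t => Real.exp t * t ^ a :=
  (isBigO_refl _ _).mul h

lemma S_asymp1 (h : Hyp g l τ ρ B) {C : ℝ}
    (hC : (fun t => mu g t - C * (t ^ τ - τ * B * t ^ (τ - 1))) =O[atTop] fun t : ℝ => t ^ (τ - 2)) :
    (fun t => S g t - C * τ * (Real.exp t * t ^ (τ - 1))) =O[atTop]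
      fun t : ℝ => Real.exp t * t ^ (τ - 2) := by
  have hQ : ∀ t, W (fun n => g n / n) Real.exp t = mu g t * Real.exp t - S g t := by
    intro t
    rw [W_eq, mu]
    congr 1
    refine S_congr (fun n hn => ?_) t
    rw [exp_log' hn]
    have : (n:ℝ) ≠ 0 := by exact_mod_cast (show n ≠ 0 by omega)
    field_simp
  have hP : ∀ t : ℝ, 0 < t → HasDerivAt (fun t : ℝ => C * (t ^ τ - τ * B * t ^ (τ - 1)) - C * τ * t ^ (τ - 1))
      (C * (τ * t ^ (τ - 1) - τ * B * ((τ - 1) * t ^ (τ - 2))) - C * τ * ((τ - 1) * t ^ (τ - 2))) t := by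
    intro t ht
    have d1 := Real.hasDerivAt_rpow_const (x := t) (p := τ) (Or.inl ht.ne')
    have d2 := Real.hasDerivAt_rpow_const (x := t) (p := τ - 1) (Or.inl ht.ne')
    rw [show τ - 1 - 1 = τ - 2 by ring] at d2
    exact ((d1.sub (d2.const_mul _)).const_mul _).sub (d2.const_mul _)
  have hO : (fun t => Real.exp t * ((mu g t - C * (t ^ τ - τ * B * t ^ (τ - 1))) +
      C * τ * (τ - 1) * (B + 1) * t ^ (τ - 2))) =O[atTop] fun t : ℝ => Real.exp t * t ^ (τ - 2) :=
    exp_mul_O (hC.add ((isBigO_refl _ _).const_mul_left _))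
  have hF := exp_rd (a := 1) (b := τ - 2)
    (F := fun t => W (fun n => g n / n) Real.exp t -
      Real.exp t * (C * (t ^ τ - τ * B * t ^ (τ - 1)) - C * τ * t ^ (τ - 1)))
    (F' := fun t => Real.exp t * ((mu g t - C * (t ^ τ - τ * B * t ^ (τ - 1))) +
      C * τ * (τ - 1) * (B + 1) * t ^ (τ - 2)))
    ((W_continuous _ Real.continuous_exp).continuousOn.sub
      (Real.continuous_exp.continuousOn.mul
        (fun t ht => (hP t (by have : (1:ℝ) ≤ t := ht; linarith)).continuousAt.continuousWithinAt)))
    (fun t ht => by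
      have := (W_deriv (fun n => g n / n) (Real.hasDerivAt_exp t)).sub
        ((Real.hasDerivAt_exp t).mul (hP t (by linarith))).hasDerivWithinAt
      refine this.congr_deriv ?_
      rw [show S (fun n => g n / n) t = mu g t from rfl]
      ring)
    hO
  refine ((exp_mul_O hC).sub hF).congr_left (fun t => ?_)
  rw [hQ]
  ring

end Moree


namespace Moree
variable {g l : ℕ → ℝ} {τ ρ B : ℝ}

lemma S_shift {C : ℝ}
    (hS : (fun t => S g t - C * τ * (Real.exp t * t ^ (τ - 1))) =O[atTop]
      fun t : ℝ => Real.exp t * t ^ (τ - 2)) :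
    ∃ K > 0, ∃ t0 ≥ 1, ∀ t ≥ t0, ∀ u, 0 ≤ u → u ≤ t / 2 →
      |S g (t - u) - C * τ * (Real.exp (t - u) * t ^ (τ - 1))| ≤
        K * (Real.exp (t - u) * ((1 + u) * t ^ (τ - 2))) := by
  obtain ⟨K, hK0, hK⟩ := hS.exists_pos
  obtain ⟨a0, ha0⟩ := eventually_atTop.1 hK.bound
  obtain ⟨K1, hK1, ht1⟩ := tay1 (τ - 1)
  refine ⟨K * 2 ^ |τ - 2| + |C * τ| * K1, by positivity, max (2 * a0) 1, le_max_right _ _, ?_⟩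
  intro t ht u hu0 hu
  have hta : 2 * a0 ≤ t := (le_max_left _ _).trans ht
  have ht0 : 1 ≤ t := (le_max_right _ _).trans ht
  have e1 := ha0 (t - u) (by linarith)
  have hp : 0 < t - u := by linarith
  rw [Real.norm_eq_abs, Real.norm_eq_abs,
    abs_of_pos (mul_pos (Real.exp_pos _) (Real.rpow_pos_of_pos hp _))] at e1
  have e2 := rpow_cmp (x := t - u) (y := t) hp (by linarith) (by linarith) (by linarith) (τ - 2)
  have e3 := ht1 t u (by linarith) (by rwa [abs_of_nonneg hu0])
  rw [abs_of_nonneg hu0, show τ - 1 - 1 = τ - 2 by ring] at e3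
  have hq : 0 ≤ t ^ (τ - 2) := by positivity
  have hE := Real.exp_pos (t - u)
  have e4 : S g (t - u) - C * τ * (Real.exp (t - u) * t ^ (τ - 1)) =
    (S g (t - u) - C * τ * (Real.exp (t - u) * (t - u) ^ (τ - 1))) +
      C * τ * (Real.exp (t - u) * ((t - u) ^ (τ - 1) - t ^ (τ - 1))) := by ring
  rw [e4]
  refine (abs_add_le _ _).trans ?_
  rw [abs_mul (C * τ), abs_mul (Real.exp _), abs_of_pos hE, add_mul]
  refine add_le_add ?_ ?_
  · refine e1.trans ?_
    calc K * (Real.exp (t - u) * (t - u) ^ (τ - 2))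
        ≤ K * (Real.exp (t - u) * (2 ^ |τ - 2| * (1 * t ^ (τ - 2)))) := by
          rw [one_mul]; gcongr
      _ ≤ K * (Real.exp (t - u) * (2 ^ |τ - 2| * ((1 + u) * t ^ (τ - 2)))) := by
          gcongr; linarith
      _ = _ := by ring
  · calc _ ≤ |C * τ| * (Real.exp (t - u) * (K1 * u * t ^ (τ - 2))) := by gcongr
      _ ≤ |C * τ| * (Real.exp (t - u) * (K1 * (1 + u) * t ^ (τ - 2))) := by gcongr; linarith
      _ = _ := by ring

lemma mu_shift {C : ℝ}
    (hC : (fun t => mu g t - C * (t ^ τ - τ * B * t ^ (τ - 1))) =O[atTop] fun t : ℝ => t ^ (τ - 2)) :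
    ∃ K > 0, ∃ t0 ≥ 1, ∀ t ≥ t0, ∀ u, 0 ≤ u → u ≤ t / 2 →
      |mu g (t - u) - C * (t ^ τ - τ * u * t ^ (τ - 1) - τ * B * t ^ (τ - 1))| ≤
        K * ((1 + u) ^ 2 * t ^ (τ - 2)) := by
  obtain ⟨K, hK0, hK⟩ := hC.exists_pos
  obtain ⟨a0, ha0⟩ := eventually_atTop.1 hK.bound
  obtain ⟨K1, hK1, ht1⟩ := tay1 (τ - 1)
  obtain ⟨K2, hK2, ht2⟩ := tay2 τ
  refine ⟨K * 2 ^ |τ - 2| + |C| * K2 + |C * τ * B| * K1, by positivity, max (2 * a0) 1, le_max_right _ _, ?_⟩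
  intro t ht u hu0 hu
  have hta : 2 * a0 ≤ t := (le_max_left _ _).trans ht
  have ht0 : 1 ≤ t := (le_max_right _ _).trans ht
  have e1 := ha0 (t - u) (by linarith)
  have hp : 0 < t - u := by linarith
  rw [Real.norm_eq_abs, Real.norm_eq_abs, abs_of_pos (Real.rpow_pos_of_pos hp _)] at e1
  have e2 := rpow_cmp (x := t - u) (y := t) hp (by linarith) (by linarith) (by linarith) (τ - 2)
  have e3 := ht1 t u (by linarith) (by rwa [abs_of_nonneg hu0])
  have e5 := ht2 t u (by linarith) (by rwa [abs_of_nonneg hu0])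
  rw [abs_of_nonneg hu0, show τ - 1 - 1 = τ - 2 by ring] at e3
  have hq : 0 ≤ t ^ (τ - 2) := by positivity
  have e4 : mu g (t - u) - C * (t ^ τ - τ * u * t ^ (τ - 1) - τ * B * t ^ (τ - 1)) =
    (mu g (t - u) - C * ((t - u) ^ τ - τ * B * (t - u) ^ (τ - 1))) +
      C * ((t - u) ^ τ - t ^ τ + τ * u * t ^ (τ - 1)) -
      (C * τ * B) * ((t - u) ^ (τ - 1) - t ^ (τ - 1)) := by ring
  rw [e4]
  refine (abs_sub _ _).trans ((add_le_add (abs_add_le _ _) le_rfl).trans ?_)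
  rw [abs_mul C, abs_mul (C * τ * B), add_mul, add_mul]
  have i1 : 1 ≤ (1 + u) ^ 2 := by nlinarith
  have i2 : u ≤ (1 + u) ^ 2 := by nlinarith
  have i3 : u ^ 2 ≤ (1 + u) ^ 2 := by nlinarith
  refine add_le_add (add_le_add ?_ ?_) ?_
  · refine e1.trans ?_
    calc K * (t - u) ^ (τ - 2)
        ≤ K * (2 ^ |τ - 2| * (1 * t ^ (τ - 2))) := by
          rw [one_mul]; gcongr
      _ ≤ K * (2 ^ |τ - 2| * ((1 + u) ^ 2 * t ^ (τ - 2))) := by gcongr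
      _ = _ := by ring
  · calc _ ≤ |C| * (K2 * u ^ 2 * t ^ (τ - 2)) := by gcongr
      _ ≤ |C| * (K2 * (1 + u) ^ 2 * t ^ (τ - 2)) := by gcongr
      _ = _ := by ring
  · calc _ ≤ |C * τ * B| * (K1 * u * t ^ (τ - 2)) := by gcongr
      _ ≤ |C * τ * B| * (K1 * (1 + u) ^ 2 * t ^ (τ - 2)) := by gcongr
      _ = _ := by ring

/-- first part of the hyperbola sum -/
lemma hyp1 (h : Hyp g l τ ρ B) {C : ℝ}
    (hS : (fun t => S g t - C * τ * (Real.exp t * t ^ (τ - 1))) =O[atTop]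
      fun t : ℝ => Real.exp t * t ^ (τ - 2)) :
    ∃ K > 0, ∃ t0 ≥ 1, ∀ t ≥ t0, ∀ v, 1 ≤ v → v ≤ t / 2 →
      |∑ n ∈ Finset.Icc 1 ⌊Real.exp v⌋₊, l n * S g (t - Real.log n)
        - Real.exp t * (C * τ * t ^ (τ - 1) * (τ * v + B))| ≤
        K * (Real.exp t * (v ^ 2 * t ^ (τ - 2) + v⁻¹ * t ^ (τ - 1))) := by
  obtain ⟨K1, hK1, t0, ht0, hsh⟩ := S_shift hS
  obtain ⟨K2, hK2, hT⟩ := h.T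
  have hτ := h.tau
  refine ⟨2 * K1 * (τ + |B| + K2) + |C * τ| * K2, by positivity, t0, ht0, ?_⟩
  intro t ht v hv1 hv
  set Tv := S (fun n => l n / n) v with hTv
  have hT1 := hT v (by linarith)
  have hpow : (1 + v) ^ (-ρ) ≤ v⁻¹ := by
    calc (1 + v) ^ (-ρ) ≤ (1 + v) ^ (-1 : ℝ) :=
          Real.rpow_le_rpow_of_exponent_le (by linarith) (by linarith [h.rho])
      _ = (1 + v)⁻¹ := Real.rpow_neg_one _
      _ ≤ v⁻¹ := by gcongr; linarith
  have hvi : v⁻¹ ≤ 1 := inv_le_one_of_one_le₀ hv1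
  have hvi0 : 0 < v⁻¹ := by positivity
  have hT2 : |Tv - τ * v - B| ≤ K2 * v⁻¹ := hT1.trans (by gcongr)
  have hT3 : Tv ≤ (τ + |B| + K2) * v := by
    have := (abs_le.1 hT2).2
    have := le_abs_self B
    have := abs_nonneg B
    nlinarith
  have htp : 0 < t := by linarith
  have hq : 0 ≤ t ^ (τ - 2) := by positivity
  have hq1 : 0 ≤ t ^ (τ - 1) := by positivity
  have e1 : |∑ n ∈ Finset.Icc 1 ⌊Real.exp v⌋₊, l n * S g (t - Real.log n)
        - Real.exp t * (C * τ * t ^ (τ - 1) * Tv)| ≤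
        K1 * (Real.exp t * (2 * v * t ^ (τ - 2))) * Tv := by
    rw [hTv, S, Finset.mul_sum, Finset.mul_sum, Finset.mul_sum, ← Finset.sum_sub_distrib]
    refine (Finset.abs_sum_le_sum_abs _ _).trans (Finset.sum_le_sum (fun n hn => ?_))
    obtain ⟨hn1, hn2⟩ := (mem_iff n v).1 hn
    have hl := log_nonneg' (n := n)
    have e := hsh t ht (Real.log n) hl (by linarith)
    rw [exp_sub_log t hn1] at e
    have : l n * S g (t - Real.log n) - Real.exp t * (C * τ * t ^ (τ - 1) * (l n / n)) =
      l n * (S g (t - Real.log n) - C * τ * (Real.exp t / n * t ^ (τ - 1))) := by ring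
    rw [this, abs_mul, abs_of_nonneg (h.l0 n)]
    have hl0 := h.l0 n
    calc _ ≤ l n * (K1 * (Real.exp t / n * ((1 + Real.log n) * t ^ (τ - 2)))) := by gcongr
      _ ≤ l n * (K1 * (Real.exp t / n * ((2 * v) * t ^ (τ - 2)))) := by gcongr; linarith
      _ = _ := by ring
  have e2 : ∑ n ∈ Finset.Icc 1 ⌊Real.exp v⌋₊, l n * S g (t - Real.log n)
        - Real.exp t * (C * τ * t ^ (τ - 1) * (τ * v + B)) =
      (∑ n ∈ Finset.Icc 1 ⌊Real.exp v⌋₊, l n * S g (t - Real.log n)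
        - Real.exp t * (C * τ * t ^ (τ - 1) * Tv)) +
      (C * τ) * (Real.exp t * t ^ (τ - 1) * (Tv - τ * v - B)) := by ring
  rw [e2]
  refine (abs_add_le _ _).trans ?_
  rw [abs_mul (C * τ), abs_mul (Real.exp t * _), abs_of_nonneg (show 0 ≤ Real.exp t * t ^ (τ - 1) by positivity)]
  have e3 : K1 * (Real.exp t * (2 * v * t ^ (τ - 2))) * Tv ≤
      2 * K1 * (τ + |B| + K2) * (Real.exp t * (v ^ 2 * t ^ (τ - 2))) := by
    calc _ ≤ K1 * (Real.exp t * (2 * v * t ^ (τ - 2))) * ((τ + |B| + K2) * v) := by gcongr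
      _ = _ := by ring
  have e4 : |C * τ| * (Real.exp t * t ^ (τ - 1) * |Tv - τ * v - B|) ≤
      |C * τ| * K2 * (Real.exp t * (v⁻¹ * t ^ (τ - 1))) := by
    calc _ ≤ |C * τ| * (Real.exp t * t ^ (τ - 1) * (K2 * v⁻¹)) := by gcongr
      _ = _ := by ring
  have e5 : 0 ≤ 2 * K1 * (τ + |B| + K2) * (Real.exp t * (v⁻¹ * t ^ (τ - 1))) := by positivity
  have e6 : 0 ≤ |C * τ| * K2 * (Real.exp t * (v ^ 2 * t ^ (τ - 2))) := by positivity
  linarith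

/-- second part of the hyperbola sum -/
lemma hyp2 (h : Hyp g l τ ρ B) :
    ∃ K > 0, ∀ t ≥ 1, ∀ v, 1 ≤ v → v ≤ t / 2 →
      |∑ d ∈ Finset.Icc 1 ⌊Real.exp (t - v)⌋₊, g d * S l (t - Real.log d)
        - τ * (Real.exp t * mu g (t - v))| ≤
        K * (Real.exp t * (v⁻¹ * t ^ (τ - 1))) := by
  obtain ⟨K1, hK1, hpsi⟩ := h.psi
  obtain ⟨K2, hK2, hw⟩ := wsum h
  refine ⟨K1 * K2 * 2 ^ |τ - 1|, by positivity, ?_⟩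
  intro t ht v hv1 hv
  rw [mu, S, Finset.mul_sum, Finset.mul_sum, ← Finset.sum_sub_distrib]
  have e1 : ∀ d ∈ Finset.Icc 1 ⌊Real.exp (t - v)⌋₊,
      |g d * S l (t - Real.log d) - τ * (Real.exp t * (g d / d))| ≤
      K1 * Real.exp t * v⁻¹ * (g d / d * (1 + (t - Real.log d)) ^ (-ρ)) := by
    intro d hd
    obtain ⟨hd1, hd2⟩ := (mem_iff d _).1 hd
    have e := hpsi (t - Real.log d) (by linarith)
    rw [exp_sub_log t hd1] at e
    have : g d * S l (t - Real.log d) - τ * (Real.exp t * (g d / d)) =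
      g d * (S l (t - Real.log d) - τ * (Real.exp t / d)) := by ring
    rw [this, abs_mul, abs_of_nonneg (h.g0 d)]
    have hp : 0 < 1 + (t - Real.log d) := by linarith
    have e2 : (1 + (t - Real.log d)) ^ (-1 - ρ) ≤ v⁻¹ * (1 + (t - Real.log d)) ^ (-ρ) := by
      rw [show -1 - ρ = -1 + -ρ by ring, Real.rpow_add hp, Real.rpow_neg_one]
      gcongr
      linarith
    have hg := h.g0 d
    calc _ ≤ g d * (K1 * (Real.exp t / d * (1 + (t - Real.log d)) ^ (-1 - ρ))) := by gcongr
      _ ≤ g d * (K1 * (Real.exp t / d * (v⁻¹ * (1 + (t - Real.log d)) ^ (-ρ)))) := by gcongr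
      _ = _ := by ring
  refine (Finset.abs_sum_le_sum_abs _ _).trans ((Finset.sum_le_sum e1).trans ?_)
  have e2 : ∑ d ∈ Finset.Icc 1 ⌊Real.exp (t - v)⌋₊,
        K1 * Real.exp t * v⁻¹ * (g d / d * (1 + (t - Real.log d)) ^ (-ρ)) ≤
      ∑ d ∈ Finset.Icc 1 ⌊Real.exp t⌋₊,
        K1 * Real.exp t * v⁻¹ * (g d / d * (1 + (t - Real.log d)) ^ (-ρ)) := by
    refine Finset.sum_le_sum_of_subset_of_nonneg (Icc_sub (by linarith)) (fun d hd _ => ?_)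
    have hd2 := ((mem_iff d _).1 hd).2
    have := h.gn d
    have : 0 ≤ (1 + (t - Real.log d)) ^ (-ρ) := Real.rpow_nonneg (by linarith) _
    positivity
  refine e2.trans ?_
  rw [← Finset.mul_sum]
  have e3 := hw t (by linarith)
  have e4 := rpow_cmp (x := 1 + t) (y := t) (by linarith) (by linarith) (by linarith) (by linarith) (τ - 1)
  calc _ ≤ K1 * Real.exp t * v⁻¹ * (K2 * (2 ^ |τ - 1| * t ^ (τ - 1))) := by
        gcongr
        exact e3.trans (by gcongr)
    _ = _ := by ring

/-- third part of the hyperbola sum -/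
lemma hyp3 (h : Hyp g l τ ρ B) {C : ℝ}
    (hS : (fun t => S g t - C * τ * (Real.exp t * t ^ (τ - 1))) =O[atTop]
      fun t : ℝ => Real.exp t * t ^ (τ - 2)) :
    ∃ K > 0, ∃ t0 ≥ 1, ∀ t ≥ t0, ∀ v, 1 ≤ v → v ≤ t / 2 →
      |S l v * S g (t - v) - Real.exp t * (C * τ * t ^ (τ - 1) * τ)| ≤
        K * (Real.exp t * (v ^ 2 * t ^ (τ - 2) + v⁻¹ * t ^ (τ - 1))) := by
  obtain ⟨K1, hK1, t0, ht0, hsh⟩ := S_shift hS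
  obtain ⟨K2, hK2, hpsi⟩ := h.psi
  have hτ := h.tau
  refine ⟨2 * (τ + K2) * K1 + |C * τ| * K2, by positivity, t0, ht0, ?_⟩
  intro t ht v hv1 hv
  have hpow : (1 + v) ^ (-1 - ρ) ≤ v⁻¹ := by
    calc (1 + v) ^ (-1 - ρ) ≤ (1 + v) ^ (-1 : ℝ) :=
          Real.rpow_le_rpow_of_exponent_le (by linarith) (by linarith [h.rho])
      _ = (1 + v)⁻¹ := Real.rpow_neg_one _
      _ ≤ v⁻¹ := by gcongr; linarith
  have hvi : v⁻¹ ≤ 1 := inv_le_one_of_one_le₀ hv1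
  have hvi0 : 0 < v⁻¹ := by positivity
  have htp : 0 < t := by linarith
  have hq : 0 ≤ t ^ (τ - 2) := by positivity
  have hq1 : 0 ≤ t ^ (τ - 1) := by positivity
  have e1 : |S l v - τ * Real.exp v| ≤ K2 * (Real.exp v * v⁻¹) :=
    (hpsi v (by linarith)).trans (by gcongr)
  have e2 : |S l v| ≤ (τ + K2) * Real.exp v := by
    rw [abs_of_nonneg (S_nonneg h.l0 v)]
    have := (abs_le.1 e1).2
    have : K2 * (Real.exp v * v⁻¹) ≤ K2 * (Real.exp v * 1) := by gcongr
    linarith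
  have e3 := hsh t ht v (by linarith) hv
  have hexp : Real.exp v * Real.exp (t - v) = Real.exp t := by
    rw [← Real.exp_add]; congr 1; ring
  have e4 : S l v * S g (t - v) - Real.exp t * (C * τ * t ^ (τ - 1) * τ) =
    S l v * (S g (t - v) - C * τ * (Real.exp (t - v) * t ^ (τ - 1))) +
    (C * τ) * ((S l v - τ * Real.exp v) * (Real.exp (t - v) * t ^ (τ - 1))) := by
    rw [← hexp]; ring
  rw [e4]
  refine (abs_add_le _ _).trans ?_
  rw [abs_mul (S l v), abs_mul (C * τ), abs_mul (_ - _) (_ * _),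
    abs_of_nonneg (show 0 ≤ Real.exp (t - v) * t ^ (τ - 1) by positivity)]
  have e5 : |S l v| * |S g (t - v) - C * τ * (Real.exp (t - v) * t ^ (τ - 1))| ≤
      2 * (τ + K2) * K1 * (Real.exp t * (v ^ 2 * t ^ (τ - 2))) := by
    calc _ ≤ ((τ + K2) * Real.exp v) * (K1 * (Real.exp (t - v) * ((1 + v) * t ^ (τ - 2)))) := by gcongr
      _ ≤ ((τ + K2) * Real.exp v) * (K1 * (Real.exp (t - v) * ((2 * v ^ 2) * t ^ (τ - 2)))) := by
          gcongr; nlinarith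
      _ = _ := by rw [← hexp]; ring
  have e6 : |C * τ| * (|S l v - τ * Real.exp v| * (Real.exp (t - v) * t ^ (τ - 1))) ≤
      |C * τ| * K2 * (Real.exp t * (v⁻¹ * t ^ (τ - 1))) := by
    calc _ ≤ |C * τ| * ((K2 * (Real.exp v * v⁻¹)) * (Real.exp (t - v) * t ^ (τ - 1))) := by gcongr
      _ = _ := by rw [← hexp]; ring
  have e7 : 0 ≤ 2 * (τ + K2) * K1 * (Real.exp t * (v⁻¹ * t ^ (τ - 1))) := by positivity
  have e8 : 0 ≤ |C * τ| * K2 * (Real.exp t * (v ^ 2 * t ^ (τ - 2))) := by positivity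
  linarith

lemma L_asymp (h : Hyp g l τ ρ B) {C : ℝ}
    (hC : (fun t => mu g t - C * (t ^ τ - τ * B * t ^ (τ - 1))) =O[atTop] fun t : ℝ => t ^ (τ - 2))
    (hS : (fun t => S g t - C * τ * (Real.exp t * t ^ (τ - 1))) =O[atTop]
      fun t : ℝ => Real.exp t * t ^ (τ - 2)) :
    (fun t => S (fun n => g n * Real.log n) t -
      Real.exp t * (C * τ * t ^ τ + (C * τ) * (B - τ - τ * B) * t ^ (τ - 1))) =O[atTop]
      fun t : ℝ => Real.exp t * t ^ (τ - 4 / 3) := by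
  obtain ⟨K1, hK1, t1, ht1, h1⟩ := hyp1 h hS
  obtain ⟨K2, hK2, h2⟩ := hyp2 h
  obtain ⟨K3, hK3, t3, ht3, h3⟩ := hyp3 h hS
  obtain ⟨K4, hK4, t4, ht4, h4⟩ := mu_shift hC
  have hτ := h.tau
  refine IsBigO.of_bound (2 * K1 + K2 + 2 * K3 + 4 * (τ * K4)) ?_
  filter_upwards [eventually_ge_atTop t1, eventually_ge_atTop t3, eventually_ge_atTop t4,
    eventually_ge_atTop 8] with t g1 g3 g4 g8
  have htp : 0 < t := by linarith
  set v := t ^ (1 / 3 : ℝ) with hv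
  have hv3 : v ^ 3 = t := by
    rw [hv, ← Real.rpow_natCast, ← Real.rpow_mul htp.le]; norm_num
  have hv1 : 2 ≤ v := by
    by_contra hcon
    have hv0 : 0 ≤ v := by positivity
    have hlt : v < 2 := not_le.1 hcon
    nlinarith [mul_nonneg hv0 hv0, mul_nonneg (mul_nonneg hv0 hv0) (sub_nonneg.2 hlt.le)]
  have hvt : v ≤ t / 2 := by nlinarith [mul_nonneg (show 0 ≤ v by linarith) (show 0 ≤ v - 2 by linarith)]
  have p1 : v ^ 2 * t ^ (τ - 2) = t ^ (τ - 4 / 3) := by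
    rw [hv, ← Real.rpow_natCast, ← Real.rpow_mul htp.le, ← Real.rpow_add htp]; congr 1; push_cast; ring
  have p2 : v⁻¹ * t ^ (τ - 1) = t ^ (τ - 4 / 3) := by
    rw [hv, ← Real.rpow_neg htp.le, ← Real.rpow_add htp]; congr 1; ring
  have q1 := h1 t g1 v (by linarith) hvt
  have q2 := h2 t (by linarith) v (by linarith) hvt
  have q3 := h3 t g3 v (by linarith) hvt
  have q4 := h4 t g4 v (by linarith) hvt
  rw [p1, p2] at q1 q3
  rw [p2] at q2
  have q4' : |τ * (Real.exp t * mu g (t - v)) - τ * (Real.exp t * (C * (t ^ τ - τ * v * t ^ (τ - 1) - τ * B * t ^ (τ - 1))))|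
      ≤ 4 * (τ * K4) * (Real.exp t * t ^ (τ - 4 / 3)) := by
    rw [← mul_sub, ← mul_sub, abs_mul, abs_mul, abs_of_pos hτ, abs_of_pos (Real.exp_pos t)]
    have hq : 0 ≤ t ^ (τ - 2) := by positivity
    calc _ ≤ τ * (Real.exp t * (K4 * ((1 + v) ^ 2 * t ^ (τ - 2)))) := by gcongr
      _ ≤ τ * (Real.exp t * (K4 * ((2 * v) ^ 2 * t ^ (τ - 2)))) := by gcongr; linarith
      _ = _ := by rw [← p1]; ring
  rw [S_congr h.D t, S_hyp g l (t := t) (v := v) (by linarith) (by linarith)]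
  have hsplit : ∑ d ∈ Finset.Icc 1 ⌊Real.exp (t - v)⌋₊, g d * (S l (t - Real.log d) - S l v) =
      ∑ d ∈ Finset.Icc 1 ⌊Real.exp (t - v)⌋₊, g d * S l (t - Real.log d) - S l v * S g (t - v) := by
    rw [S, S, mul_comm, Finset.sum_mul, ← Finset.sum_sub_distrib]
    exact Finset.sum_congr rfl (fun d _ => by rw [S]; ring)
  rw [hsplit, Real.norm_eq_abs, Real.norm_eq_abs,
    abs_of_pos (mul_pos (Real.exp_pos _) (Real.rpow_pos_of_pos htp _))]
  rw [abs_le] at q1 q2 q3 q4' ⊢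
  have hid : t ^ τ = t ^ τ := rfl
  constructor
  · linarith [q1.1, q2.1, q3.2, q4'.1]
  · linarith [q1.2, q2.2, q3.1, q4'.2]

lemma S_asymp2 (h : Hyp g l τ ρ B) : ∃ C > 0,
    (fun t => S g t - Real.exp t * (C * t ^ (τ - 1) + C * ((1 - τ) * (1 + B)) * t ^ (τ - 2)))
      =O[atTop] fun t : ℝ => Real.exp t * t ^ (τ - 7 / 3) := by
  obtain ⟨C, hC0, hC⟩ := mu_asymp h
  have hS := S_asymp1 h hC
  have hL := L_asymp h hC hS
  have hτ := h.tau
  have hP : ∀ t : ℝ, 0 < t → HasDerivAt (fun t : ℝ => C * τ * t ^ (τ - 1))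
      (C * τ * ((τ - 1) * t ^ (τ - 2))) t := by
    intro t ht
    have d2 := Real.hasDerivAt_rpow_const (x := t) (p := τ - 1) (Or.inl ht.ne')
    rw [show τ - 1 - 1 = τ - 2 by ring] at d2
    exact d2.const_mul _
  have hF := exp_rd (a := 1) (b := τ - 2)
    (F := fun t => W g (fun s => s) t - Real.exp t * (C * τ * t ^ (τ - 1)))
    (F' := fun t => (S g t - C * τ * (Real.exp t * t ^ (τ - 1))) -
      Real.exp t * (C * τ * (τ - 1) * t ^ (τ - 2)))
    ((W_continuous _ continuous_id).continuousOn.sub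
      (Real.continuous_exp.continuousOn.mul
        (fun t ht => (hP t (by have : (1:ℝ) ≤ t := ht; linarith)).continuousAt.continuousWithinAt)))
    (fun t ht => by
      have := (W_deriv g (hasDerivAt_id' t)).sub
        ((Real.hasDerivAt_exp t).mul (hP t (by linarith))).hasDerivWithinAt
      refine this.congr_deriv ?_
      ring)
    (hS.sub (exp_mul_O ((isBigO_refl _ _).const_mul_left _)))
  have hF' := hF.trans (exp_mul_O (pow_le_O (show τ - 2 ≤ τ - 4 / 3 by linarith)))
  refine ⟨C * τ, by positivity, ?_⟩
  have hsum := hL.add hF'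
  have hinv : (fun t : ℝ => t⁻¹) =O[atTop] fun t : ℝ => t⁻¹ := isBigO_refl _ _
  refine (hsum.mul hinv).congr' ?_ ?_
  · filter_upwards [eventually_gt_atTop 0] with t ht
    rw [W_eq]
    have e1 : t ^ τ = t ^ (τ - 1) * t := by rw [Real.rpow_sub_one ht.ne']; field_simp
    have e2 : t ^ (τ - 1) = t ^ (τ - 2) * t := by
      rw [show τ - 2 = τ - 1 - 1 by ring, Real.rpow_sub_one ht.ne' (τ - 1)]; field_simp
    rw [e1, e2]
    field_simp
    ring
  · filter_upwards [eventually_gt_atTop 0] with t ht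
    rw [show τ - 7 / 3 = (τ - 4 / 3) - 1 by ring, Real.rpow_sub_one ht.ne']
    field_simp

end Moree


namespace Moree

noncomputable def ell (t : ℝ) : ℝ := ∫ s in (2:ℝ)..Real.exp t, 1 / Real.log s

lemma ell_deriv {t : ℝ} (ht : 0 < t) : HasDerivAt ell (Real.exp t / t) t := by
  have h1 : (1:ℝ) < Real.exp t := by rw [← Real.exp_zero]; exact Real.exp_lt_exp.2 ht
  have hcont : ContinuousOn (fun s : ℝ => 1 / Real.log s) (Set.Ioi 1) := by
    refine ContinuousOn.div continuousOn_const ?_ ?_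
    · exact Real.continuousOn_log.mono (fun x hx => by
        have : (1:ℝ) < x := hx
        simp; linarith)
    · intro x hx; exact (Real.log_pos hx).ne'
  have hsub : Set.uIcc 2 (Real.exp t) ⊆ Set.Ioi 1 := by
    intro x hx
    have := hx.1
    show 1 < x
    exact lt_of_lt_of_le (lt_min (by norm_num) h1) this
  have hd := intervalIntegral.integral_hasDerivAt_right (f := fun s : ℝ => 1 / Real.log s)
    (a := 2) (b := Real.exp t) ((hcont.mono hsub).intervalIntegrable)
    (hcont.stronglyMeasurableAtFilter isOpen_Ioi _ h1)
    (hcont.continuousAt (Ioi_mem_nhds h1))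
  have := hd.comp t (Real.hasDerivAt_exp t)
  refine this.congr_deriv ?_
  rw [Real.log_exp]; ring

lemma S_locbd {l : ℕ → ℝ} (hl : ∀ n, 0 ≤ l n) (T : ℝ) : ∀ t, t ≤ T → |S l t| ≤ S l T := by
  intro t ht
  rw [abs_of_nonneg (S_nonneg hl t)]
  exact S_mono hl ht

lemma prime_psi {a : ℕ → ℝ} {τ ρ : ℝ} (ha : ∀ n, 0 ≤ a n)
    (hA : (fun t => S a t - τ * ell t) =O[atTop] fun t => Real.exp t * t ^ (-2 - ρ)) :
    ∃ K > 0, ∀ t ≥ 0, |S (fun n => a n * Real.log n) t - τ * Real.exp t|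
      ≤ K * (Real.exp t * (1 + t) ^ (-1 - ρ)) := by
  have hF := exp_rd (F := fun t => W a (fun s => s) t - τ * (t * ell t - Real.exp t))
    (F' := fun t => S a t - τ * ell t) (a := 1) (b := -2 - ρ)
    (by
      refine ContinuousOn.sub (W_continuous a continuous_id).continuousOn ?_
      refine continuousOn_const.mul (ContinuousOn.sub (continuousOn_id.mul ?_)
        Real.continuous_exp.continuousOn)
      intro t ht
      have : (1:ℝ) ≤ t := ht
      exact (ell_deriv (by linarith)).continuousAt.continuousWithinAt)
    (by
      intro t ht
      have ht0 : 0 < t := by linarith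
      have h1 := W_deriv a (φ := fun s => s) (hasDerivAt_id t)
      have h2 := (((hasDerivAt_id t).mul (ell_deriv ht0)).sub (Real.hasDerivAt_exp t)).const_mul τ
      refine (h1.sub h2.hasDerivWithinAt).congr_deriv ?_
      simp only [id]
      field_simp
      ring) hA
  have hr : (fun t => (S a t - τ * ell t) * t) =O[atTop] fun t => Real.exp t * t ^ (-1 - ρ) := by
    refine (hA.mul (isBigO_refl (fun t : ℝ => t) _)).congr' EventuallyEq.rfl ?_
    filter_upwards [eventually_gt_atTop 0] with t ht
    rw [mul_assoc, ← Real.rpow_add_one ht.ne']; congr 2; ring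
  have hF2 := hF.trans (exp_mul_O (pow_le_O (show -2 - ρ ≤ -1 - ρ by linarith)))
  have hS := hr.sub hF2
  have hq : (fun t => (S (fun n => a n * Real.log n) t - τ * Real.exp t) * Real.exp (-t)) =O[atTop]
      fun t => t ^ (-1 - ρ) := by
    refine (hS.mul (isBigO_refl (fun t : ℝ => Real.exp (-t)) _)).congr ?_ ?_
    · intro t
      have := W_eq a (fun s => s) t
      rw [this]; ring
    · intro t
      rw [Real.exp_neg]; field_simp
  have hl : ∀ n : ℕ, 0 ≤ a n * Real.log n := fun n => mul_nonneg (ha n) (log_nonneg')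
  obtain ⟨K, hK, h⟩ := ext_bd hq (by
    intro T
    refine ⟨S (fun n => a n * Real.log n) T + |τ| , fun t h0 hT => ?_⟩
    have hb := S_locbd hl T t hT
    rw [sub_mul, mul_assoc, ← Real.exp_add, add_neg_cancel, Real.exp_zero, mul_one]
    refine (abs_sub _ _).trans (add_le_add ?_ le_rfl)
    rw [abs_mul, abs_of_pos (Real.exp_pos _)]
    have : Real.exp (-t) ≤ 1 := Real.exp_le_one_iff.2 (by linarith)
    nlinarith [abs_nonneg (S (fun n => a n * Real.log n) t), Real.exp_pos (-t)])
  refine ⟨K, hK, fun t ht => ?_⟩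
  have := h t ht
  rw [abs_mul, abs_of_pos (Real.exp_pos _), Real.exp_neg, ← div_eq_mul_inv,
    div_le_iff₀ (Real.exp_pos _)] at this
  linarith

lemma prime_T {a : ℕ → ℝ} {τ ρ : ℝ} (ha : ∀ n, 0 ≤ a n) (hρ : 1 < ρ)
    (hA : (fun t => S a t - τ * ell t) =O[atTop] fun t => Real.exp t * t ^ (-2 - ρ)) :
    ∃ B, ∃ K > 0, ∀ t ≥ 0, |S (fun n => a n * Real.log n / n) t - τ * t - B|
      ≤ K * (1 + t) ^ (-ρ) := by
  have hφ : ∀ t, HasDerivAt (fun t : ℝ => t * Real.exp (-t)) ((1 - t) * Real.exp (-t)) t := by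
    intro t
    have := (hasDerivAt_id t).mul ((Real.hasDerivAt_exp (-t)).comp t (hasDerivAt_neg t))
    refine this.congr_deriv ?_
    simp; ring
  have hφc : Continuous (fun t : ℝ => t * Real.exp (-t)) := by fun_prop
  have h1t : (fun t : ℝ => 1 - t) =O[atTop] fun t : ℝ => t := by
    refine IsBigO.of_bound 2 ?_
    filter_upwards [eventually_ge_atTop 1] with t ht
    rw [Real.norm_eq_abs, Real.norm_eq_abs, abs_of_nonpos (by linarith), abs_of_nonneg (by linarith)]
    linarith
  have hr1 : (fun t => (S a t - τ * ell t) * (t * Real.exp (-t))) =O[atTop]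
      fun t => t ^ (-1 - ρ) := by
    refine (hA.mul (isBigO_refl (fun t : ℝ => t * Real.exp (-t)) _)).congr' EventuallyEq.rfl ?_
    filter_upwards [eventually_gt_atTop 0] with t ht
    rw [show (-1 - ρ) = (-2 - ρ) + 1 by ring, Real.rpow_add_one ht.ne', Real.exp_neg]
    field_simp
  have hr2 : (fun t => (S a t - τ * ell t) * ((1 - t) * Real.exp (-t))) =O[atTop]
      fun t => t ^ (-1 - ρ) := by
    refine (hA.mul (h1t.mul (isBigO_refl (fun t : ℝ => Real.exp (-t)) _))).congr' EventuallyEq.rfl ?_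
    filter_upwards [eventually_gt_atTop 0] with t ht
    rw [show (-1 - ρ) = (-2 - ρ) + 1 by ring, Real.rpow_add_one ht.ne', Real.exp_neg]
    field_simp
  obtain ⟨L, hL⟩ := conv_rd
    (F := fun t => W a (fun t : ℝ => t * Real.exp (-t)) t - τ * (ell t * (t * Real.exp (-t)) - t))
    (F' := fun t => (S a t - τ * ell t) * ((1 - t) * Real.exp (-t))) (a := 1) (b := ρ) (by linarith)
    (by
      refine ContinuousOn.sub (W_continuous a hφc).continuousOn ?_
      refine continuousOn_const.mul (ContinuousOn.sub (ContinuousOn.mul ?_ hφc.continuousOn)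
        continuousOn_id)
      intro t ht
      have : (1:ℝ) ≤ t := ht
      exact (ell_deriv (by linarith)).continuousAt.continuousWithinAt)
    (by
      intro t ht
      have ht0 : 0 < t := by linarith
      have h1 := W_deriv a (hφ t)
      have h2 := (((ell_deriv ht0).mul (hφ t)).sub (hasDerivAt_id t)).const_mul τ
      refine (h1.sub h2.hasDerivWithinAt).congr_deriv ?_
      rw [Real.exp_neg]
      field_simp
      ring) hr2
  have hq : (fun t => S (fun n => a n * Real.log n / n) t - τ * t - (-L)) =O[atTop]
      fun t => t ^ (-ρ) := by
    refine ((hr1.trans (pow_le_O (show -1 - ρ ≤ -ρ by linarith))).sub hL).congr_left ?_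
    intro t
    have := W_eq a (fun t : ℝ => t * Real.exp (-t)) t
    have h3 : S (fun n => a n * (Real.log n * Real.exp (-Real.log n))) t =
        S (fun n => a n * Real.log n / n) t := by
      refine S_congr (fun n hn => ?_) t
      rw [Real.exp_neg, exp_log' hn]; ring
    rw [h3] at this
    rw [this]; ring
  have hl : ∀ n : ℕ, 0 ≤ a n * Real.log n / n := fun n =>
    div_nonneg (mul_nonneg (ha n) (log_nonneg')) (Nat.cast_nonneg n)
  refine ⟨-L, ext_bd hq ?_⟩
  intro T
  refine ⟨S (fun n => a n * Real.log n / n) T + |τ| * T + |-L|, fun t h0 hT => ?_⟩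
  have hb := S_locbd hl T t hT
  refine (abs_sub _ _).trans (add_le_add ?_ le_rfl)
  refine (abs_sub _ _).trans (add_le_add hb ?_)
  rw [abs_mul, abs_of_nonneg h0]
  exact mul_le_mul_of_nonneg_left hT (abs_nonneg _)

end Moree


namespace Moree

/-- exponential of a prime supported function -/
noncomputable def E (a : ℕ → ℝ) : ArithmeticFunction ℝ :=
  ⟨fun n => if n = 0 then 0 else n.factorization.prod (fun p r => a p ^ r / (r.factorial : ℝ)), by simp⟩

lemma E_apply (a : ℕ → ℝ) {n : ℕ} (hn : n ≠ 0) :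
    E a n = n.factorization.prod (fun p r => a p ^ r / (r.factorial : ℝ)) := by
  show (if n = 0 then 0 else _) = _
  rw [if_neg hn]

lemma E_one (a : ℕ → ℝ) : E a 1 = 1 := by
  rw [E_apply a one_ne_zero]; simp

lemma E_mul (a : ℕ → ℝ) : (E a).IsMultiplicative := by
  refine ⟨E_one a, fun {m n} hmn => ?_⟩
  by_cases hm : m = 0
  · simp [hm]
  by_cases hn : n = 0
  · simp [hn]
  rw [E_apply a hm, E_apply a hn, E_apply a (mul_ne_zero hm hn),
    Nat.factorization_mul_of_coprime hmn]
  exact Finsupp.prod_add_index_of_disjoint hmn.disjoint_primeFactors _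

lemma E_prime_pow (a : ℕ → ℝ) {p : ℕ} (hp : p.Prime) (r : ℕ) :
    E a (p ^ r) = a p ^ r / (r.factorial : ℝ) := by
  rw [E_apply a (pow_ne_zero _ hp.ne_zero), hp.factorization_pow]
  simp

lemma E_nonneg {a : ℕ → ℝ} (ha : ∀ p, p.Prime → 0 ≤ a p) (n : ℕ) : 0 ≤ E a n := by
  by_cases hn : n = 0
  · simp [hn]
  rw [E_apply a hn]
  refine Finset.prod_nonneg (fun p hp => ?_)
  exact div_nonneg (pow_nonneg (ha p (Nat.prime_of_mem_primeFactors hp)) _) (Nat.cast_nonneg _)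

/-- the von Mangoldt type function -/
noncomputable def lam (a : ℕ → ℝ) : ArithmeticFunction ℝ :=
  ⟨fun n => if n.Prime then a n * Real.log n else 0, by simp [Nat.not_prime_zero]⟩

lemma E_step (a : ℕ → ℝ) {n p : ℕ} (hn : n ≠ 0) (hp : p ∈ n.primeFactors) :
    E a n * n.factorization p = a p * E a (n / p) := by
  have hpp := Nat.prime_of_mem_primeFactors hp
  have hdvd := Nat.dvd_of_mem_primeFactors hp
  obtain ⟨k, m, hm, hk⟩ := Nat.exists_eq_pow_mul_and_not_dvd hn p hpp.ne_one
  have hk0 : k ≠ 0 := by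
    rintro rfl
    simp at hk; subst hk; exact hm hdvd
  obtain ⟨j, rfl⟩ := Nat.exists_eq_succ_of_ne_zero hk0
  have hm0 : m ≠ 0 := by rintro rfl; simp at hm
  have hcop : ∀ i, Nat.Coprime (p ^ i) m := fun i =>
    Nat.Coprime.pow_left _ ((Nat.Prime.coprime_iff_not_dvd hpp).2 hm)
  have h1 : n / p = p ^ j * m := by
    rw [hk, pow_succ, Nat.div_eq_of_eq_mul_right hpp.pos]; ring
  have h2 : n.factorization p = j + 1 := by
    rw [hk, Nat.factorization_mul (pow_ne_zero _ hpp.ne_zero) hm0, hpp.factorization_pow]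
    simp [Nat.factorization_eq_zero_of_not_dvd hm]
  rw [h1, h2, hk, (E_mul a).2 (hcop _), (E_mul a).2 (hcop _), E_prime_pow a hpp, E_prime_pow a hpp,
    Nat.factorial_succ]
  push_cast
  have : (j.factorial : ℝ) ≠ 0 := by exact_mod_cast j.factorial_ne_zero
  have : (j : ℝ) + 1 ≠ 0 := by positivity
  rw [Nat.succ_eq_add_one, pow_succ]
  field_simp

lemma log_fact {n : ℕ} (hn : n ≠ 0) :
    Real.log n = ∑ p ∈ n.primeFactors, n.factorization p * Real.log p := by
  conv_lhs => rw [← Nat.prod_factorization_pow_eq_self hn]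
  rw [Finsupp.prod, Nat.cast_prod, Real.log_prod]
  · refine Finset.sum_congr rfl (fun p hp => ?_)
    push_cast
    rw [Real.log_pow]
  · intro p hp
    have := (Nat.prime_of_mem_primeFactors hp).ne_zero
    positivity

lemma E_D (a : ℕ → ℝ) (n : ℕ) : E a n * Real.log n = (E a * lam a) n := by
  by_cases hn : n = 0
  · simp [hn]
  rw [mul_comm (E a), ArithmeticFunction.mul_apply,
    Nat.sum_divisorsAntidiagonal (f := fun x y => lam a x * E a y), log_fact hn, Finset.mul_sum]
  rw [Nat.primeFactors_eq_to_filter_divisors_prime, Finset.sum_filter]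
  refine Finset.sum_congr rfl (fun d hd => ?_)
  show _ = (if d.Prime then a d * Real.log d else 0) * _
  split_ifs with hp
  · have := E_step a hn (Nat.mem_primeFactors.2 ⟨hp, Nat.dvd_of_mem_divisors hd, hn⟩)
    rw [← mul_assoc, this]; ring
  · ring

/-- log derivation -/
noncomputable def Dl (a : ArithmeticFunction ℝ) : ArithmeticFunction ℝ :=
  ⟨fun n => a n * Real.log n, by simp⟩

lemma Dl_apply (a : ArithmeticFunction ℝ) (n : ℕ) : Dl a n = a n * Real.log n := rfl

lemma Dl_mul (a b : ArithmeticFunction ℝ) : Dl (a * b) = Dl a * b + a * Dl b := by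
  ext n
  rw [Dl_apply, ArithmeticFunction.add_apply, ArithmeticFunction.mul_apply,
    ArithmeticFunction.mul_apply, ArithmeticFunction.mul_apply, Finset.sum_mul,
    ← Finset.sum_add_distrib]
  refine Finset.sum_congr rfl (fun x hx => ?_)
  obtain ⟨h1, h2⟩ := Nat.mem_divisorsAntidiagonal.1 hx
  have hx1 : x.1 ≠ 0 := by intro h; rw [h] at h1; simp at h1; exact h2 h1.symm
  have hx2 : x.2 ≠ 0 := by intro h; rw [h] at h1; simp at h1; exact h2 h1.symm
  rw [Dl_apply, Dl_apply, ← h1, Nat.cast_mul, Real.log_mul (by exact_mod_cast hx1)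
    (by exact_mod_cast hx2)]
  ring

lemma lam_neg (a : ℕ → ℝ) : lam (fun p => - a p) = - lam a := by
  ext n
  show (if n.Prime then - a n * Real.log n else 0) = -(if n.Prime then a n * Real.log n else 0)
  split_ifs <;> simp

lemma DE (a : ℕ → ℝ) : Dl (E a) = E a * lam a := by
  ext n; exact E_D a n

lemma E_inv (a : ℕ → ℝ) : E a * E (fun p => - a p) = 1 := by
  have h : Dl (E a * E (fun p => - a p)) = 0 := by
    rw [Dl_mul, DE, DE, lam_neg]; ring
  ext n
  by_cases hn : n = 1
  · subst hn
    rw [((E_mul a).mul (E_mul _)).1]; simp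
  · by_cases hn0 : n = 0
    · simp [hn0]
    have := congrArg (fun b : ArithmeticFunction ℝ => b n) h
    simp only [Dl_apply, ArithmeticFunction.zero_apply] at this
    rw [ArithmeticFunction.one_apply_ne hn]
    refine (mul_eq_zero.1 this).resolve_right ?_
    exact (Real.log_pos (by exact_mod_cast (by omega : 1 < n))).ne'

/-- make an arithmetic function -/
noncomputable def mk0 (f : ℕ → ℝ) : ArithmeticFunction ℝ := ⟨fun n => if n = 0 then 0 else f n, by simp⟩

lemma mk0_apply (f : ℕ → ℝ) {n : ℕ} (hn : n ≠ 0) : mk0 f n = f n := by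
  show (if n = 0 then 0 else _) = _
  rw [if_neg hn]

lemma mk0_mul {f : ℕ → ℝ} (hf1 : f 1 = 1)
    (hfmult : ∀ m n : ℕ, Nat.Coprime m n → f (m * n) = f m * f n) : (mk0 f).IsMultiplicative := by
  refine ⟨by rw [mk0_apply f one_ne_zero, hf1], fun {m n} hmn => ?_⟩
  by_cases hm : m = 0
  · simp [hm]
  by_cases hn : n = 0
  · simp [hn]
  rw [mk0_apply f hm, mk0_apply f hn, mk0_apply f (mul_ne_zero hm hn), hfmult m n hmn]

/-- quotient -/
noncomputable def hh (f : ℕ → ℝ) : ArithmeticFunction ℝ := mk0 f * E (fun p => - f p)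

lemma hh_mul {f : ℕ → ℝ} (hf1 : f 1 = 1)
    (hfmult : ∀ m n : ℕ, Nat.Coprime m n → f (m * n) = f m * f n) : (hh f).IsMultiplicative :=
  (mk0_mul hf1 hfmult).mul (E_mul _)

lemma hh_spec (f : ℕ → ℝ) : hh f * E f = mk0 f := by
  rw [hh, mul_assoc, mul_comm (E fun p => - f p), E_inv, mul_one]

lemma hh_D {f Λf : ℕ → ℝ}
    (hΛf : ∀ n : ℕ, 1 ≤ n → f n * Real.log n = ∑ d ∈ n.divisors, f d * Λf (n / d)) :
    Dl (hh f) = hh f * (mk0 Λf - lam f) := by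
  have h1 : Dl (mk0 f) = mk0 f * mk0 Λf := by
    ext n
    by_cases hn : n = 0
    · simp [hn]
    rw [Dl_apply, mk0_apply f hn, hΛf n (by omega), ArithmeticFunction.mul_apply,
      Nat.sum_divisorsAntidiagonal (f := fun x y => mk0 f x * mk0 Λf y)]
    refine Finset.sum_congr rfl (fun d hd => ?_)
    have hd' := Nat.dvd_of_mem_divisors hd
    have hd0 : 0 < d := Nat.pos_of_mem_divisors hd
    rw [mk0_apply f hd0.ne', mk0_apply Λf (Nat.div_pos (Nat.le_of_dvd (by omega) hd') hd0).ne']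
  rw [hh, Dl_mul, DE, lam_neg, h1]; ring

lemma mul_cv (a b : ArithmeticFunction ℝ) (n : ℕ) : (a * b) n = cv a b n := by
  rw [ArithmeticFunction.mul_apply, Nat.sum_divisorsAntidiagonal (f := fun x y => a x * b y), cv]

lemma hh_pp (f : ℕ → ℝ) {p : ℕ} (hp : p.Prime) (r : ℕ) :
    hh f (p ^ r) = ∑ k ∈ Finset.range (r + 1),
      f (p ^ k) * ((- f p) ^ (r - k) / ((r - k).factorial : ℝ)) := by
  rw [hh, mul_cv, cv, Nat.divisors_prime_pow hp, Finset.sum_map]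
  refine Finset.sum_congr rfl (fun k hk => ?_)
  have hk' : k ≤ r := by simpa [Nat.lt_succ_iff] using hk
  simp only [Function.Embedding.coeFn_mk]
  rw [Nat.pow_div hk' hp.pos, E_prime_pow _ hp, mk0_apply f (pow_ne_zero _ hp.ne_zero)]

lemma hh_p {f : ℕ → ℝ} (hf1 : f 1 = 1) {p : ℕ} (hp : p.Prime) : hh f p = 0 := by
  have := hh_pp f hp 1
  rw [pow_one] at this
  rw [this]
  simp [Finset.sum_range_succ, hf1]

lemma hh_bd {f : ℕ → ℝ} {c₁ c₂ : ℝ} (hf1 : f 1 = 1) (hc₁ : 1 ≤ c₁) (hc₂ : 1 ≤ c₂)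
    (hbound : ∀ p r : ℕ, p.Prime → 1 ≤ r → 0 ≤ f (p ^ r) ∧ f (p ^ r) ≤ c₁ * c₂ ^ r)
    {p : ℕ} (hp : p.Prime) (r : ℕ) : |hh f (p ^ r)| ≤ c₁ * Real.exp c₁ * c₂ ^ r := by
  have hb : ∀ k, |f (p ^ k)| ≤ c₁ * c₂ ^ k := by
    intro k
    rcases Nat.eq_zero_or_pos k with rfl | hk
    · simpa [hf1] using hc₁
    · rw [abs_of_nonneg (hbound p k hp hk).1]; exact (hbound p k hp hk).2
  have hfp : |f p| ≤ c₁ * c₂ := by simpa using hb 1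
  rw [hh_pp f hp]
  refine (Finset.abs_sum_le_sum_abs _ _).trans ?_
  have h1 : ∀ k ∈ Finset.range (r + 1), |f (p ^ k) * ((- f p) ^ (r - k) / ((r - k).factorial : ℝ))|
      ≤ c₁ * c₂ ^ r * (c₁ ^ (r + 1 - 1 - k) / ((r + 1 - 1 - k).factorial : ℝ)) := by
    intro k hk
    have hk' : k ≤ r := by simpa [Nat.lt_succ_iff] using hk
    rw [abs_mul, abs_div, abs_pow, abs_neg, Nat.abs_cast, Nat.add_sub_cancel]
    calc |f (p ^ k)| * (|f p| ^ (r - k) / ((r - k).factorial : ℝ))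
        ≤ (c₁ * c₂ ^ k) * ((c₁ * c₂) ^ (r - k) / ((r - k).factorial : ℝ)) := by
          gcongr
          exact hb k
      _ = c₁ * (c₂ ^ k * c₂ ^ (r - k)) * (c₁ ^ (r - k) / ((r - k).factorial : ℝ)) := by
          rw [mul_pow]; ring
      _ = _ := by rw [← pow_add, Nat.add_sub_cancel' hk']
  refine (Finset.sum_le_sum h1).trans ?_
  rw [← Finset.mul_sum, Finset.sum_range_reflect (fun j => c₁ ^ j / (j.factorial : ℝ)) (r + 1)]
  have := Real.sum_le_exp_of_nonneg (by linarith : 0 ≤ c₁) (r + 1)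
  calc c₁ * c₂ ^ r * ∑ j ∈ Finset.range (r + 1), c₁ ^ j / (j.factorial : ℝ)
      ≤ c₁ * c₂ ^ r * Real.exp c₁ := by gcongr
    _ = _ := by ring

end Moree


namespace Moree

lemma loc_bd {x : ℕ → ℝ} {C q q0 : ℝ} (hC : 0 ≤ C) (hq : 0 ≤ q) (hq0 : q ≤ q0) (hq1 : q0 < 1)
    (hx : ∀ r, 0 ≤ x r) (hx' : ∀ r, x r ≤ C * q ^ r) (h0 : x 0 = 1) (h1 : x 1 = 0) :
    Summable x ∧ ∑' r, x r ≤ 1 + C / (1 - q0) * q ^ 2 := by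
  have hgs : Summable (fun r => C * q ^ r) :=
    (summable_geometric_of_lt_one hq (by linarith)).mul_left C
  have hs : Summable x := Summable.of_nonneg_of_le hx hx' hgs
  refine ⟨hs, ?_⟩
  rw [← hs.sum_add_tsum_nat_add 2]
  simp only [Finset.sum_range_succ, Finset.sum_range_zero, h0, h1, zero_add, add_zero]
  have h2 : ∑' r, x (r + 2) ≤ ∑' r : ℕ, C * q ^ 2 * q ^ r := by
    refine Summable.tsum_le_tsum (fun r => ?_) ((summable_nat_add_iff 2).2 hs)
      ((summable_geometric_of_lt_one hq (by linarith)).mul_left _)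
    refine (hx' (r + 2)).trans (le_of_eq ?_)
    ring
  rw [tsum_mul_left, tsum_geometric_of_lt_one hq (by linarith)] at h2
  have h3 : (1 - q)⁻¹ ≤ (1 - q0)⁻¹ := inv_anti₀ (by linarith) (by linarith)
  have h4 : C * q ^ 2 * (1 - q)⁻¹ ≤ C * q ^ 2 * (1 - q0)⁻¹ := by gcongr
  have : C / (1 - q0) * q ^ 2 = C * q ^ 2 * (1 - q0)⁻¹ := by ring
  linarith

lemma mult_summable {k : ℕ → ℝ} {M σ : ℝ} (hk : ∀ n, 0 ≤ k n) (hk0 : k 0 = 0) (hk1 : k 1 = 1)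
    (hm : ∀ {m n : ℕ}, Nat.Coprime m n → k (m * n) = k m * k n) (hσ : 1 / 2 < σ) (hM : 0 ≤ M)
    (hp : ∀ {p : ℕ}, p.Prime → Summable (fun r => k (p ^ r)) ∧
      ∑' r, k (p ^ r) ≤ 1 + M * (p : ℝ) ^ (-(2 * σ))) : Summable k := by
  have hs : Summable (fun n : ℕ => (n : ℝ) ^ (-(2 * σ))) :=
    Real.summable_nat_rpow.2 (by linarith)
  have hnn : ∀ n : ℕ, 0 ≤ (n : ℝ) ^ (-(2 * σ)) := fun n => Real.rpow_nonneg (Nat.cast_nonneg n) _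
  refine summable_of_sum_le (c := Real.exp (M * ∑' n : ℕ, (n : ℝ) ^ (-(2 * σ)))) hk ?_
  intro s
  obtain ⟨N, hN⟩ : ∃ N, ∀ n ∈ s, n < N := ⟨s.sup id + 1, fun n hn =>
    Nat.lt_succ_of_le (Finset.le_sup (f := id) hn)⟩
  obtain ⟨h1, h2⟩ := EulerProduct.summable_and_hasSum_smoothNumbers_prod_primesBelow_tsum
    (f := k) hk1 hm (fun {p} hpp => by
      have := (hp hpp).1
      simpa [Real.norm_eq_abs, abs_of_nonneg (hk _)] using this) N
  have h3 : ∑ n ∈ s, k n ≤ ∏ p ∈ N.primesBelow, ∑' r, k (p ^ r) := by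
    have e : ∑ n ∈ s, k n = ∑ n ∈ s.erase 0, k n := by
      by_cases h0 : 0 ∈ s
      · rw [← Finset.add_sum_erase s k h0, hk0, zero_add]
      · rw [Finset.erase_eq_of_notMem h0]
    have hmem : ∀ n ∈ s.erase 0, n ∈ N.smoothNumbers := by
      intro n hn
      rw [Finset.mem_erase] at hn
      rw [Nat.mem_smoothNumbers']
      intro p hpp hd
      exact lt_of_le_of_lt (Nat.le_of_dvd (Nat.pos_of_ne_zero hn.1) hd) (hN n hn.2)
    rw [e, ← h2.tsum_eq, ← Finset.sum_subtype_of_mem k hmem]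
    exact h2.summable.sum_le_tsum _ (fun i _ => hk _)
  refine h3.trans ?_
  calc ∏ p ∈ N.primesBelow, ∑' r, k (p ^ r)
      ≤ ∏ p ∈ N.primesBelow, Real.exp (M * (p : ℝ) ^ (-(2 * σ))) := by
        refine Finset.prod_le_prod (fun p _ => tsum_nonneg (fun r => hk _)) (fun p hp' => ?_)
        refine (hp (Nat.prime_of_mem_primesBelow hp')).2.trans ?_
        rw [add_comm]
        exact Real.add_one_le_exp _
    _ = Real.exp (M * ∑ p ∈ N.primesBelow, (p : ℝ) ^ (-(2 * σ))) := by
        rw [← Real.exp_sum, Finset.mul_sum]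
    _ ≤ _ := by
        gcongr
        exact hs.sum_le_tsum _ (fun n _ => hnn n)

lemma exists_sigma {c : ℝ} (h1 : 1 ≤ c) (h2 : c < 2) :
    ∃ σ : ℝ, 1 / 2 < σ ∧ σ < 1 ∧ c * (2:ℝ) ^ (-σ) < 1 := by
  have hl : Real.logb 2 c < 1 := by
    rw [Real.logb_lt_iff_lt_rpow (by norm_num) (by linarith)]; simpa using h2
  refine ⟨max (3 / 4) ((1 + Real.logb 2 c) / 2), ?_, ?_, ?_⟩
  · exact lt_of_lt_of_le (by norm_num) (le_max_left _ _)
  · exact max_lt (by norm_num) (by linarith)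
  · have : c < (2:ℝ) ^ (max (3 / 4) ((1 + Real.logb 2 c) / 2)) := by
      rw [← Real.logb_lt_iff_lt_rpow (by norm_num) (by linarith)]
      exact lt_of_lt_of_le (by linarith) (le_max_right _ _)
    rw [Real.rpow_neg (by norm_num), ← div_eq_mul_inv, div_lt_one (by positivity)]
    exact this

variable {f : ℕ → ℝ} {c₁ c₂ : ℝ}

lemma kk_loc (hf1 : f 1 = 1) (hfmult : ∀ m n : ℕ, Nat.Coprime m n → f (m * n) = f m * f n)
    (hc₁ : 1 ≤ c₁) (hc₂ : 1 ≤ c₂)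
    (hbound : ∀ p r : ℕ, p.Prime → 1 ≤ r → 0 ≤ f (p ^ r) ∧ f (p ^ r) ≤ c₁ * c₂ ^ r)
    {σ : ℝ} (hσ0 : 1 / 2 < σ) (hσ : c₂ * (2:ℝ) ^ (-σ) < 1) :
    ∃ M ≥ 0, ∀ {p : ℕ}, p.Prime → Summable (fun r => |hh f (p ^ r)| * ((p ^ r : ℕ) : ℝ) ^ (-σ)) ∧
      ∑' r, |hh f (p ^ r)| * ((p ^ r : ℕ) : ℝ) ^ (-σ) ≤ 1 + M * (p : ℝ) ^ (-(2 * σ)) := by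
  have hpos : 0 ≤ c₁ * Real.exp c₁ / (1 - c₂ * (2:ℝ) ^ (-σ)) :=
    div_nonneg (by positivity) (by linarith)
  refine ⟨c₁ * Real.exp c₁ / (1 - c₂ * (2:ℝ) ^ (-σ)) * c₂ ^ 2, by positivity, ?_⟩
  intro p hp
  have hp2 : (2:ℝ) ≤ p := by exact_mod_cast hp.two_le
  have hpw : ∀ r : ℕ, ((p ^ r : ℕ) : ℝ) ^ (-σ) = ((p : ℝ) ^ (-σ)) ^ r := by
    intro r
    push_cast
    rw [← Real.rpow_natCast, ← Real.rpow_natCast, ← Real.rpow_mul (by positivity),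
      ← Real.rpow_mul (by positivity), mul_comm]
  have := loc_bd (x := fun r => |hh f (p ^ r)| * ((p ^ r : ℕ) : ℝ) ^ (-σ))
    (C := c₁ * Real.exp c₁) (q := c₂ * (p : ℝ) ^ (-σ)) (q0 := c₂ * (2:ℝ) ^ (-σ))
    (by positivity) (by positivity) (by
      gcongr c₂ * ?_
      exact Real.rpow_le_rpow_of_nonpos (by norm_num) hp2 (by linarith)) hσ
    (fun r => by positivity) (fun r => by
      rw [hpw, mul_pow, ← mul_assoc]
      gcongr
      exact hh_bd hf1 hc₁ hc₂ hbound hp r) (by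
      simp [(hh_mul hf1 hfmult).1]) (by simp [hh_p hf1 hp])
  refine ⟨this.1, this.2.trans (le_of_eq ?_)⟩
  have e : ((p : ℝ) ^ (-σ)) ^ 2 = (p : ℝ) ^ (-(2 * σ)) := by
    rw [← Real.rpow_natCast, ← Real.rpow_mul (by positivity)]; congr 1; push_cast; ring
  rw [mul_pow, e]; ring

lemma hh_summable (hf1 : f 1 = 1) (hfmult : ∀ m n : ℕ, Nat.Coprime m n → f (m * n) = f m * f n)
    (hc₁ : 1 ≤ c₁) (hc₂ : 1 ≤ c₂)
    (hbound : ∀ p r : ℕ, p.Prime → 1 ≤ r → 0 ≤ f (p ^ r) ∧ f (p ^ r) ≤ c₁ * c₂ ^ r)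
    {σ : ℝ} (hσ0 : 1 / 2 < σ) (hσ : c₂ * (2:ℝ) ^ (-σ) < 1) :
    Summable (fun n : ℕ => |hh f n| * (n : ℝ) ^ (-σ)) := by
  obtain ⟨M, hM, h⟩ := kk_loc hf1 hfmult hc₁ hc₂ hbound hσ0 hσ
  refine mult_summable (M := M) (σ := σ) (fun n => by positivity) (by simp)
    (by simp [(hh_mul hf1 hfmult).1]) ?_ hσ0 hM h
  intro m n hmn
  rw [(hh_mul hf1 hfmult).2 hmn, abs_mul, Nat.cast_mul,
    Real.mul_rpow (Nat.cast_nonneg _) (Nat.cast_nonneg _)]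
  ring

lemma hh_moment (hf1 : f 1 = 1) (hfmult : ∀ m n : ℕ, Nat.Coprime m n → f (m * n) = f m * f n)
    (hc₁ : 1 ≤ c₁) (hc₂ : 1 ≤ c₂) (hc₂' : c₂ < 2)
    (hbound : ∀ p r : ℕ, p.Prime → 1 ≤ r → 0 ≤ f (p ^ r) ∧ f (p ^ r) ≤ c₁ * c₂ ^ r) :
    Summable (fun n : ℕ => |hh f n| / n * (1 + Real.log n) ^ 3) := by
  obtain ⟨σ, h1, h2, h3⟩ := exists_sigma hc₂ hc₂'
  have hs := hh_summable hf1 hfmult hc₁ hc₂ hbound h1 h3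
  set ε := (1 - σ) / 3 with hε
  have hε0 : 0 < ε := by rw [hε]; linarith
  refine Summable.of_nonneg_of_le (fun n => ?_) (fun n => ?_) (hs.mul_left ((1 + 1 / ε) ^ 3))
  · have := log_nonneg' (n := n)
    positivity
  · by_cases hn : n = 0
    · simp [hn]
    have hn1 : (1:ℝ) ≤ n := by exact_mod_cast (show 1 ≤ n by omega)
    have hn0 : (0:ℝ) < n := by linarith
    have hl := Real.log_le_rpow_div hn0.le hε0
    have h1' : 1 ≤ (n:ℝ) ^ ε := Real.one_le_rpow hn1 hε0.le
    have hlog : 1 + Real.log n ≤ (1 + 1 / ε) * (n : ℝ) ^ ε := by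
      calc 1 + Real.log n ≤ (n:ℝ) ^ ε + (n:ℝ) ^ ε / ε := add_le_add h1' hl
        _ = _ := by ring
    have := log_nonneg' (n := n)
    have e : ((n : ℝ) ^ ε) ^ 3 = (n : ℝ) ^ (-σ) * n := by
      rw [← Real.rpow_natCast, ← Real.rpow_mul hn0.le, ← Real.rpow_add_one hn0.ne']
      congr 1; rw [hε]; push_cast; ring
    calc |hh f n| / n * (1 + Real.log n) ^ 3
        ≤ |hh f n| / n * ((1 + 1 / ε) * (n : ℝ) ^ ε) ^ 3 := by gcongr
      _ = _ := by rw [mul_pow, e]; field_simp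

lemma loc_pos (hf1 : f 1 = 1) (hc₁ : 1 ≤ c₁) (hc₂ : 1 ≤ c₂) (hc₂' : c₂ < 2)
    (hbound : ∀ p r : ℕ, p.Prime → 1 ≤ r → 0 ≤ f (p ^ r) ∧ f (p ^ r) ≤ c₁ * c₂ ^ r)
    {p : ℕ} (hp : p.Prime) : 0 < ∑' r : ℕ, hh f (p ^ r) / ((p ^ r : ℕ) : ℝ) := by
  have hp2 : (2:ℝ) ≤ p := by exact_mod_cast hp.two_le
  have hp0 : (p : ℝ) ≠ 0 := by positivity
  have hn : ∀ k, 0 ≤ f (p ^ k) := by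
    intro k
    rcases Nat.eq_zero_or_pos k with rfl | hk
    · simp [hf1]
    · exact (hbound p k hp hk).1
  have hb : ∀ k, f (p ^ k) ≤ c₁ * c₂ ^ k := by
    intro k
    rcases Nat.eq_zero_or_pos k with rfl | hk
    · simpa [hf1] using hc₁
    · exact (hbound p k hp hk).2
  have hs1 : Summable (fun k : ℕ => f (p ^ k) / (p : ℝ) ^ k) := by
    refine Summable.of_nonneg_of_le (fun k => div_nonneg (hn k) (by positivity)) (fun k => ?_)
      ((summable_geometric_of_lt_one (r := c₂ / p) (by positivity)
        (by rw [div_lt_one (by linarith)]; linarith)).mul_left c₁)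
    rw [div_pow, ← mul_div_assoc]
    exact div_le_div_of_nonneg_right (hb k) (by positivity)
  have hs2 := Real.summable_pow_div_factorial (- f p / p)
  have key := tsum_mul_tsum_eq_tsum_sum_range_of_summable_norm hs1.norm hs2.norm
  have e1 : ∑' n : ℕ, (- f p / p) ^ n / (n.factorial : ℝ) = Real.exp (- f p / p) := by
    rw [Real.exp_eq_exp_ℝ, NormedSpace.exp_eq_tsum_div]
  have e2 : ∀ r : ℕ, ∑ k ∈ Finset.range (r + 1), f (p ^ k) / (p : ℝ) ^ k *
      ((- f p / p) ^ (r - k) / ((r - k).factorial : ℝ)) = hh f (p ^ r) / ((p ^ r : ℕ) : ℝ) := by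
    intro r
    rw [hh_pp f hp, Finset.sum_div]
    refine Finset.sum_congr rfl (fun k hk => ?_)
    have hk' : k ≤ r := by simpa [Nat.lt_succ_iff] using hk
    push_cast
    rw [← Nat.add_sub_cancel' hk', pow_add, Nat.add_sub_cancel_left, div_pow]
    field_simp
  simp_rw [e2] at key
  rw [← key, e1]
  refine mul_pos ?_ (Real.exp_pos _)
  refine lt_of_lt_of_le zero_lt_one ?_
  have := hs1.le_tsum 0 (fun k _ => div_nonneg (hn k) (by positivity))
  simpa [hf1] using this

lemma tail_bd {x y : ℕ → ℝ} {m : ℝ} (h : ∀ r, ‖x r‖ ≤ y r) (hy : Summable y) (hx0 : x 0 = 1)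
    (hy0 : y 0 = 1) (hm : ∑' r, y r ≤ 1 + m) : ‖(∑' r, x r) - 1‖ ≤ m := by
  have hs : Summable (fun r => ‖x r‖) := Summable.of_nonneg_of_le (fun n => norm_nonneg _) h hy
  have hs1 : Summable (fun r => ‖x (r + 1)‖) := (summable_nat_add_iff (f := fun r => ‖x r‖) 1).2 hs
  rw [hs.of_norm.tsum_eq_zero_add, hx0, add_sub_cancel_left]
  rw [hy.tsum_eq_zero_add, hy0] at hm
  refine (norm_tsum_le_tsum_norm hs1).trans ?_
  refine le_trans ?_ ((add_le_add_iff_left _).1 hm)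
  exact Summable.tsum_le_tsum (fun r => h _) hs1 ((summable_nat_add_iff 1).2 hy)

lemma H0_pos (hf1 : f 1 = 1) (hfmult : ∀ m n : ℕ, Nat.Coprime m n → f (m * n) = f m * f n)
    (hc₁ : 1 ≤ c₁) (hc₂ : 1 ≤ c₂) (hc₂' : c₂ < 2)
    (hbound : ∀ p r : ℕ, p.Prime → 1 ≤ r → 0 ≤ f (p ^ r) ∧ f (p ^ r) ≤ c₁ * c₂ ^ r) :
    0 < ∑' n : ℕ, hh f n / n := by
  obtain ⟨σ, h1, h2, h3⟩ := exists_sigma hc₂ hc₂'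
  have hs := hh_summable hf1 hfmult hc₁ hc₂ hbound h1 h3
  obtain ⟨M, hM, hloc⟩ := kk_loc hf1 hfmult hc₁ hc₂ hbound h1 h3
  have hle : ∀ n : ℕ, ‖hh f n / n‖ ≤ |hh f n| * (n : ℝ) ^ (-σ) := by
    intro n
    by_cases hn : n = 0
    · simp [hn]
    have hn1 : (1:ℝ) ≤ n := by exact_mod_cast (show 1 ≤ n by omega)
    rw [norm_div, Real.norm_eq_abs, Real.norm_eq_abs, Nat.abs_cast, div_eq_mul_inv,
      ← Real.rpow_neg_one]
    gcongr
  have hsn : Summable (fun n : ℕ => ‖hh f n / n‖) :=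
    Summable.of_nonneg_of_le (fun n => norm_nonneg _) hle hs
  have hE := EulerProduct.eulerProduct_tprod (f := fun n : ℕ => hh f n / n)
    (by simp [(hh_mul hf1 hfmult).1]) (fun {m n} hmn => by
      rw [(hh_mul hf1 hfmult).2 hmn, Nat.cast_mul]
      field_simp) hsn (by simp)
  rw [← hE]
  have hu : Summable (fun p : Nat.Primes =>
      (∑' e : ℕ, hh f ((p : ℕ) ^ e) / (((p : ℕ) ^ e : ℕ) : ℝ)) - 1) := by
    refine Summable.of_norm_bounded (g := fun p : Nat.Primes => M * (p : ℝ) ^ (-(2 * σ)))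
      ((Nat.Primes.summable_rpow.2 (by linarith)).mul_left M) (fun p => ?_)
    obtain ⟨ha, hb⟩ := hloc p.2
    exact tail_bd (x := fun e : ℕ => hh f ((p : ℕ) ^ e) / (((p : ℕ) ^ e : ℕ) : ℝ))
      (fun r => hle _) ha (by simp [(hh_mul hf1 hfmult).1]) (by simp [(hh_mul hf1 hfmult).1]) hb
  have hlog := Real.summable_log_one_add_of_summable hu
  simp only [add_sub_cancel] at hlog
  rw [← Real.rexp_tsum_eq_tprod
    (fun p : Nat.Primes => loc_pos hf1 hc₁ hc₂ hc₂' hbound p.2) hlog]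
  exact Real.exp_pos _

end Moree


namespace Moree

lemma dom_conv {a : ℕ → ℝ} {φ : ℝ → ℝ} {L M : ℝ} (ha : Summable (fun n => |a n|)) (ha0 : a 0 = 0)
    (hM : ∀ t, |φ t| ≤ M) (hφ : Tendsto φ atTop (𝓝 L)) :
    Tendsto (fun t => ∑ d ∈ Finset.Icc 1 ⌊Real.exp t⌋₊, a d * φ (t - Real.log d)) atTop
      (𝓝 ((∑' d, a d) * L)) := by
  have h := tendsto_tsum_of_dominated_convergence (𝓕 := atTop)
    (f := fun (t : ℝ) (d : ℕ) => if d ∈ Finset.Icc 1 ⌊Real.exp t⌋₊ then a d * φ (t - Real.log d) else 0)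
    (g := fun d => a d * L) (bound := fun d => |a d| * M) (ha.mul_right M) (by
      intro d
      by_cases hd : d = 0
      · subst hd
        simp [ha0]
      have h1 : Tendsto (fun t : ℝ => a d * φ (t - Real.log d)) atTop (𝓝 (a d * L)) :=
        (hφ.comp (tendsto_atTop_add_const_right _ (-Real.log d) tendsto_id)).const_mul _
      refine h1.congr' ?_
      filter_upwards [eventually_ge_atTop (Real.log d)] with t ht
      rw [if_pos ((mem_iff d t).2 ⟨by omega, ht⟩)]) (by
      refine Eventually.of_forall (fun t d => ?_)
      split_ifs
      · rw [Real.norm_eq_abs, abs_mul]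
        exact mul_le_mul_of_nonneg_left (hM _) (abs_nonneg _)
      · rw [norm_zero]
        exact mul_nonneg (abs_nonneg _) ((abs_nonneg _).trans (hM 0)))
  rw [← tsum_mul_right]
  refine h.congr (fun t => ?_)
  rw [tsum_eq_sum (s := Finset.Icc 1 ⌊Real.exp t⌋₊) (fun d hd => if_neg hd)]
  exact Finset.sum_congr rfl (fun d hd => if_pos hd)

lemma sum_w {b : ℕ → ℝ} (hs : Summable (fun n : ℕ => |b n| / n * (1 + Real.log n) ^ 3))
    {w : ℕ → ℝ} {c : ℝ} (hw : ∀ n, |w n| ≤ c * (1 + Real.log n) ^ 3) :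
    Summable (fun n : ℕ => b n / n * w n) := by
  refine Summable.of_norm_bounded (hs.mul_left c) (fun n => ?_)
  rw [norm_mul, norm_div, Real.norm_eq_abs, Real.norm_eq_abs, Real.norm_eq_abs, Nat.abs_cast]
  calc |b n| / n * |w n| ≤ |b n| / n * (c * (1 + Real.log n) ^ 3) := by
        have := hw n
        gcongr
    _ = _ := by ring

lemma sum_0 {b : ℕ → ℝ} (hs : Summable (fun n : ℕ => |b n| / n * (1 + Real.log n) ^ 3)) :
    Summable (fun n : ℕ => b n / n) := by
  have := sum_w hs (w := fun _ => 1) (c := 1) (fun n => by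
    rw [abs_one, one_mul]
    exact one_le_pow₀ (by linarith [log_nonneg' (n := n)]))
  simpa using this

lemma sum_1 {b : ℕ → ℝ} (hs : Summable (fun n : ℕ => |b n| / n * (1 + Real.log n) ^ 3)) :
    Summable (fun n : ℕ => b n / n * Real.log n) := by
  refine sum_w hs (c := 1) (fun n => ?_)
  have := log_nonneg' (n := n)
  rw [abs_of_nonneg this, one_mul]
  nlinarith [pow_nonneg this 3, pow_nonneg this 2]

lemma link {h m : ℕ → ℝ} {β : ℝ} (hs : Summable (fun n : ℕ => |h n| / n * (1 + Real.log n) ^ 3))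
    (hD : ∀ n, 1 ≤ n → h n * Real.log n = cv h m n)
    (hm : Tendsto (fun t => S (fun n => m n / n) t) atTop (𝓝 β)) :
    ∑' n : ℕ, h n / n * Real.log n = (∑' n : ℕ, h n / n) * β := by
  have h1 := dom_conv (a := fun n : ℕ => h n / n * Real.log n) (φ := fun _ => 1) (L := 1) (M := 1)
    (sum_1 hs).norm (by simp) (by simp) tendsto_const_nhds
  obtain ⟨T, hT⟩ := eventually_atTop.1 (hm.eventually (Metric.ball_mem_nhds β one_pos))
  have h2 := dom_conv (a := fun n : ℕ => h n / n) (φ := fun t => S (fun n => m n / n) t) (L := β)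
    (M := max (|β| + 1) (S (fun n => |m n / n|) T)) (sum_0 hs).norm (by simp) (by
      intro t
      rcases le_total T t with ht | ht
      · refine le_max_of_le_left ?_
        have := hT t ht
        rw [Real.dist_eq] at this
        have h3 := abs_sub_abs_le_abs_sub (S (fun n => m n / n) t) β
        linarith
      · refine le_max_of_le_right ?_
        exact (Finset.abs_sum_le_sum_abs _ _).trans (S_mono (fun n => abs_nonneg _) ht)) hm
  have h3 := tendsto_nhds_unique (h1.congr (fun t => ?_)) h2
  · simpa using h3
  · rw [← S_cv (fun n : ℕ => h n / n) (fun n => m n / n) t]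
    simp only [mul_one]
    refine S_congr (fun n hn => ?_) t
    rw [cv_div _ _ n hn, ← hD n hn]; ring

variable {g l : ℕ → ℝ} {τ ρ B : ℝ}

lemma R_exp (h : Hyp g l τ ρ B) {C : ℝ}
    (hS : (fun t => S g t - Real.exp t * (C * t ^ (τ - 1) + C * ((1 - τ) * (1 + B)) * t ^ (τ - 2)))
      =O[atTop] fun t => Real.exp t * t ^ (τ - 7 / 3)) :
    ∃ K > 0, ∃ t0 ≥ 1, ∀ t ≥ t0, ∀ u ≥ 0,
      |S g (t - u) * Real.exp (-(t - u)) - (C * t ^ (τ - 1) +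
        C * ((1 - τ) * (1 + B) + (1 - τ) * u) * t ^ (τ - 2))| ≤
        K * (1 + u) ^ 3 * t ^ (τ - 7 / 3) := by
  have hτ := h.tau
  obtain ⟨K1, hK1, hb⟩ := hS.exists_pos
  obtain ⟨a0, ha0⟩ := eventually_atTop.1 hb.bound
  obtain ⟨K2, hK2, hT2⟩ := tay2 (τ - 1)
  obtain ⟨K3, hK3, hT1⟩ := tay1 (τ - 2)
  obtain ⟨K4, hK4, hU⟩ := S_upper h
  set D := C * ((1 - τ) * (1 + B)) with hD
  refine ⟨K1 * 2 ^ |τ - 7 / 3| + |C| * K2 + |D| * K3 + K4 * 2 ^ τ * 8 + |C| * 4 + |D| * 2 +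
    |C| * |1 - τ| * 2, by positivity, max 2 (2 * |a0|),
    le_max_of_le_left (by norm_num), fun t ht u hu => ?_⟩
  have ht2 : 2 ≤ t := (le_max_left _ _).trans ht
  have hta : 2 * |a0| ≤ t := (le_max_right _ _).trans ht
  have ht0 : 0 < t := by linarith
  have ht1 : 1 ≤ t := by linarith
  set X := t ^ (τ - 7 / 3) with hX
  have hX0 : 0 < X := Real.rpow_pos_of_pos ht0 _
  have hle3 : t ^ (τ - 3) ≤ X := Real.rpow_le_rpow_of_exponent_le ht1 (by linarith)
  have hp1 : (1:ℝ) ≤ 1 + u := by linarith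
  have hc1 : u ≤ (1 + u) ^ 3 := by nlinarith [pow_nonneg hu 3, pow_nonneg hu 2]
  have hc2 : u ^ 2 ≤ (1 + u) ^ 3 := by nlinarith [pow_nonneg hu 3, pow_nonneg hu 2]
  have hc3 : u ^ 3 ≤ (1 + u) ^ 3 := by nlinarith [pow_nonneg hu 3, pow_nonneg hu 2]
  have hc0 : 1 ≤ (1 + u) ^ 3 := by nlinarith [pow_nonneg hu 3, pow_nonneg hu 2]
  set Y := (1 + u) ^ 3 with hY
  have hY0 : 0 < Y := by linarith
  have eP : C * t ^ (τ - 1) + C * ((1 - τ) * (1 + B) + (1 - τ) * u) * t ^ (τ - 2) =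
      C * t ^ (τ - 1) + D * t ^ (τ - 2) + C * (1 - τ) * u * t ^ (τ - 2) := by rw [hD]; ring
  rw [eP]
  have extra : ∀ z, |z| ≤ (K1 * 2 ^ |τ - 7 / 3| + |C| * K2 + |D| * K3) * (Y * X) ∨
      |z| ≤ (K4 * 2 ^ τ * 8 + |C| * 4 + |D| * 2 + |C| * |1 - τ| * 2) * (Y * X) →
      |z| ≤ (K1 * 2 ^ |τ - 7 / 3| + |C| * K2 + |D| * K3 + K4 * 2 ^ τ * 8 + |C| * 4 + |D| * 2 +
    |C| * |1 - τ| * 2) * Y * X := by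
    intro z hz
    have p1 : 0 ≤ (K1 * 2 ^ |τ - 7 / 3| + |C| * K2 + |D| * K3) * (Y * X) := by positivity
    have p2 : 0 ≤ (K4 * 2 ^ τ * 8 + |C| * 4 + |D| * 2 + |C| * |1 - τ| * 2) * (Y * X) := by positivity
    rcases hz with hz | hz <;> linarith
  apply extra
  rcases le_or_gt u (t / 2) with hu2 | hu2
  · left
    have hs0 : 0 < t - u := by linarith
    have hsa : a0 ≤ t - u := by linarith [le_abs_self a0]
    have b1 := ha0 (t - u) hsa
    rw [norm_mul, Real.norm_eq_abs, Real.norm_eq_abs, Real.norm_eq_abs,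
      abs_of_pos (Real.exp_pos _), abs_of_pos (Real.rpow_pos_of_pos hs0 _)] at b1
    have b2 := hT2 t u ht0 (by rw [abs_of_nonneg hu]; exact hu2)
    have b3 := hT1 t u ht0 (by rw [abs_of_nonneg hu]; exact hu2)
    rw [show τ - 1 - 1 = τ - 2 by ring, show τ - 1 - 2 = τ - 3 by ring] at b2
    rw [show τ - 2 - 1 = τ - 3 by ring, abs_of_nonneg hu] at b3
    have b4 := rpow_cmp hs0 ht0 (by linarith) (by linarith) (τ - 7 / 3)
    have hE : Real.exp (t - u) * Real.exp (-(t - u)) = 1 := by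
      rw [← Real.exp_add, add_neg_cancel, Real.exp_zero]
    set s := t - u with hs
    have b1' : |S g s * Real.exp (-s) - (C * s ^ (τ - 1) + D * s ^ (τ - 2))| ≤
        K1 * s ^ (τ - 7 / 3) := by
      have e : S g s * Real.exp (-s) - (C * s ^ (τ - 1) + D * s ^ (τ - 2)) =
        (S g s - Real.exp s * (C * s ^ (τ - 1) + D * s ^ (τ - 2))) * Real.exp (-s) := by
        rw [sub_mul, mul_right_comm (Real.exp s), hE, one_mul]
      rw [e, abs_mul, abs_of_pos (Real.exp_pos _)]
      calc _ ≤ K1 * (Real.exp s * s ^ (τ - 7 / 3)) * Real.exp (-s) := by gcongr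
        _ = K1 * s ^ (τ - 7 / 3) * (Real.exp s * Real.exp (-s)) := by ring
        _ = _ := by rw [hE, mul_one]
    have e : S g s * Real.exp (-s) - (C * t ^ (τ - 1) + D * t ^ (τ - 2) +
        C * (1 - τ) * u * t ^ (τ - 2)) =
        (S g s * Real.exp (-s) - (C * s ^ (τ - 1) + D * s ^ (τ - 2))) +
        C * (s ^ (τ - 1) - t ^ (τ - 1) + (τ - 1) * u * t ^ (τ - 2)) +
        D * (s ^ (τ - 2) - t ^ (τ - 2)) := by ring
    rw [e]
    refine (abs_add_three _ _ _).trans ?_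
    rw [abs_mul, abs_mul]
    have q1 : K1 * s ^ (τ - 7 / 3) ≤ K1 * 2 ^ |τ - 7 / 3| * (Y * X) := by
      calc K1 * s ^ (τ - 7 / 3) ≤ K1 * (2 ^ |τ - 7 / 3| * X) := by gcongr
        _ = K1 * 2 ^ |τ - 7 / 3| * (1 * X) := by ring
        _ ≤ _ := by gcongr
    have q2 : |C| * |s ^ (τ - 1) - t ^ (τ - 1) + (τ - 1) * u * t ^ (τ - 2)| ≤ |C| * K2 * (Y * X) := by
      calc _ ≤ |C| * (K2 * u ^ 2 * t ^ (τ - 3)) := by gcongr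
        _ ≤ |C| * (K2 * Y * X) := by gcongr
        _ = _ := by ring
    have q3 : |D| * |s ^ (τ - 2) - t ^ (τ - 2)| ≤ |D| * K3 * (Y * X) := by
      calc _ ≤ |D| * (K3 * u * t ^ (τ - 3)) := by gcongr
        _ ≤ |D| * (K3 * Y * X) := by gcongr
        _ = _ := by ring
    linarith
  · right
    have htu : t ≤ 2 * u := by linarith
    have r0 : t ^ τ ≤ t ^ 3 * X := by
      rw [hX, ← Real.rpow_natCast, ← Real.rpow_add ht0]
      exact Real.rpow_le_rpow_of_exponent_le ht1 (by push_cast; linarith)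
    have r1 : t ^ (τ - 1) ≤ t ^ 2 * X := by
      rw [hX, ← Real.rpow_natCast, ← Real.rpow_add ht0]
      exact Real.rpow_le_rpow_of_exponent_le ht1 (by push_cast; linarith)
    have r2 : t ^ (τ - 2) ≤ t ^ 1 * X := by
      rw [hX, ← Real.rpow_natCast, ← Real.rpow_add ht0]
      exact Real.rpow_le_rpow_of_exponent_le ht1 (by push_cast; linarith)
    have s3 : t ^ 3 ≤ 8 * Y := by
      calc t ^ 3 ≤ (2 * u) ^ 3 := by gcongr
        _ = 8 * u ^ 3 := by ring
        _ ≤ _ := by gcongr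
    have s2 : t ^ 2 ≤ 4 * Y := by
      calc t ^ 2 ≤ (2 * u) ^ 2 := by gcongr
        _ = 4 * u ^ 2 := by ring
        _ ≤ _ := by gcongr
    have s1 : t ^ 1 ≤ 2 * Y := by
      rw [pow_one]; linarith
    have s1' : u * t ^ 1 ≤ 2 * Y := by
      rw [pow_one]
      calc u * t ≤ u * (2 * u) := by gcongr
        _ = 2 * u ^ 2 := by ring
        _ ≤ _ := by gcongr
    have hR : |S g (t - u) * Real.exp (-(t - u))| ≤ K4 * 2 ^ τ * 8 * (Y * X) := by
      rcases lt_or_ge (t - u) 0 with hn | hn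
      · rw [S_neg g hn]; simp; positivity
      · rw [abs_of_nonneg (mul_nonneg (S_nonneg h.g0 _) (Real.exp_pos _).le)]
        have hE : Real.exp (t - u) * Real.exp (-(t - u)) = 1 := by
          rw [← Real.exp_add, add_neg_cancel, Real.exp_zero]
        have := hU (t - u) hn
        calc S g (t - u) * Real.exp (-(t - u))
            ≤ K4 * (Real.exp (t - u) * (1 + (t - u)) ^ (τ - 1)) * Real.exp (-(t - u)) := by gcongr
          _ = K4 * (1 + (t - u)) ^ (τ - 1) * (Real.exp (t - u) * Real.exp (-(t - u))) := by ring
          _ = K4 * (1 + (t - u)) ^ (τ - 1) := by rw [hE, mul_one]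
          _ ≤ K4 * (1 + (t - u)) ^ τ := by
              gcongr
              · linarith
              · linarith
          _ ≤ K4 * (2 * t) ^ τ := by
              gcongr
              linarith
          _ = K4 * (2 ^ τ * t ^ τ) := by rw [Real.mul_rpow (by norm_num) ht0.le]
          _ ≤ K4 * (2 ^ τ * (8 * Y * X)) := by
              have : t ^ τ ≤ 8 * Y * X := r0.trans (by gcongr)
              gcongr
          _ = _ := by ring
    have q1 : |C * t ^ (τ - 1)| ≤ |C| * 4 * (Y * X) := by
      rw [abs_mul, abs_of_pos (Real.rpow_pos_of_pos ht0 _)]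
      have : t ^ (τ - 1) ≤ 4 * Y * X := r1.trans (by gcongr)
      calc _ ≤ |C| * (4 * Y * X) := by gcongr
        _ = _ := by ring
    have q2 : |D * t ^ (τ - 2)| ≤ |D| * 2 * (Y * X) := by
      rw [abs_mul, abs_of_pos (Real.rpow_pos_of_pos ht0 _)]
      have : t ^ (τ - 2) ≤ 2 * Y * X := r2.trans (by gcongr)
      calc _ ≤ |D| * (2 * Y * X) := by gcongr
        _ = _ := by ring
    have q3 : |C * (1 - τ) * u * t ^ (τ - 2)| ≤ |C| * |1 - τ| * 2 * (Y * X) := by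
      rw [abs_mul, abs_mul, abs_mul, abs_of_pos (Real.rpow_pos_of_pos ht0 _), abs_of_nonneg hu]
      calc |C| * |1 - τ| * u * t ^ (τ - 2) ≤ |C| * |1 - τ| * u * (t ^ 1 * X) := by gcongr
        _ = |C| * |1 - τ| * ((u * t ^ 1) * X) := by ring
        _ ≤ |C| * |1 - τ| * ((2 * Y) * X) := by gcongr
        _ = _ := by ring
    refine (abs_sub _ _).trans ?_
    have := abs_add_three (C * t ^ (τ - 1)) (D * t ^ (τ - 2)) (C * (1 - τ) * u * t ^ (τ - 2))
    linarith

lemma transfer (h : Hyp g l τ ρ B) {b : ℕ → ℝ} (hb0 : b 0 = 0)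
    (hs : Summable (fun n : ℕ => |b n| / n * (1 + Real.log n) ^ 3)) :
    ∃ C > 0, (fun t => S (cv b g) t - Real.exp t * (C * (∑' n : ℕ, b n / n) * t ^ (τ - 1) +
      C * ((1 - τ) * (1 + B) * (∑' n : ℕ, b n / n) + (1 - τ) * ∑' n : ℕ, b n / n * Real.log n)
        * t ^ (τ - 2))) =O[atTop] fun t => Real.exp t * t ^ (τ - 7 / 3) := by
  obtain ⟨C, hC, hS⟩ := S_asymp2 h
  refine ⟨C, hC, ?_⟩
  obtain ⟨K, hK, t0, ht01, hR⟩ := R_exp h hS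
  refine IsBigO.of_bound (K * ∑' n : ℕ, |b n| / n * (1 + Real.log n) ^ 3) ?_
  filter_upwards [eventually_ge_atTop t0] with t ht
  have ht0 : 0 < t := by linarith
  set P : ℕ → ℝ := fun n => C * t ^ (τ - 1) +
        C * ((1 - τ) * (1 + B) + (1 - τ) * Real.log n) * t ^ (τ - 2) with hP
  set R : ℕ → ℝ := fun n => S g (t - Real.log n) * Real.exp (-(t - Real.log n)) with hRd
  have hd : ∀ n : ℕ, |R n - P n| ≤ K * t ^ (τ - 7 / 3) * (1 + Real.log n) ^ 3 := by
    intro n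
    refine (hR t ht _ (log_nonneg' (n := n))).trans (le_of_eq ?_)
    ring
  have s1 := sum_w hs hd
  have sP : HasSum (fun n : ℕ => b n / n * P n) (C * (∑' n : ℕ, b n / n) * t ^ (τ - 1) +
      C * ((1 - τ) * (1 + B) * (∑' n : ℕ, b n / n) + (1 - τ) * ∑' n : ℕ, b n / n * Real.log n)
        * t ^ (τ - 2)) := by
    have := ((sum_0 hs).hasSum.mul_left (C * t ^ (τ - 1) + C * ((1 - τ) * (1 + B)) * t ^ (τ - 2))).add
      ((sum_1 hs).hasSum.mul_left (C * (1 - τ) * t ^ (τ - 2)))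
    have e1 : (fun n : ℕ => b n / n * P n) = fun n : ℕ =>
      (C * t ^ (τ - 1) + C * ((1 - τ) * (1 + B)) * t ^ (τ - 2)) * (b n / n) +
        C * (1 - τ) * t ^ (τ - 2) * (b n / n * Real.log n) := by
      funext n; rw [hP]; ring
    rw [e1]
    have e2 : C * (∑' n : ℕ, b n / n) * t ^ (τ - 1) +
      C * ((1 - τ) * (1 + B) * (∑' n : ℕ, b n / n) + (1 - τ) * ∑' n : ℕ, b n / n * Real.log n)
        * t ^ (τ - 2) = (C * t ^ (τ - 1) + C * ((1 - τ) * (1 + B)) * t ^ (τ - 2)) *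
        (∑' n : ℕ, b n / n) + C * (1 - τ) * t ^ (τ - 2) * ∑' n : ℕ, b n / n * Real.log n := by ring
    rw [e2]
    exact this
  have eS : S (cv b g) t = Real.exp t * ∑' n : ℕ, b n / n * R n := by
    rw [S_cv, tsum_eq_sum (s := Finset.Icc 1 ⌊Real.exp t⌋₊), Finset.mul_sum]
    · refine Finset.sum_congr rfl (fun n hn => ?_)
      have hn1 := ((mem_iff n t).1 hn).1
      rw [hRd]
      simp only
      rw [Real.exp_neg, exp_sub_log t hn1]
      have : (n : ℝ) ≠ 0 := by exact_mod_cast (show n ≠ 0 by omega)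
      have := (Real.exp_pos t).ne'
      field_simp
    · intro n hn
      by_cases hn0 : n = 0
      · simp [hn0, hb0]
      · rw [mem_iff] at hn
        push Not at hn
        have := hn (by omega)
        rw [hRd]
        simp only
        rw [S_neg g (by linarith)]; simp
  have eD : ∑' n : ℕ, b n / n * (R n - P n) = (∑' n : ℕ, b n / n * R n) -
      (C * (∑' n : ℕ, b n / n) * t ^ (τ - 1) +
      C * ((1 - τ) * (1 + B) * (∑' n : ℕ, b n / n) + (1 - τ) * ∑' n : ℕ, b n / n * Real.log n)
        * t ^ (τ - 2)) := by
    have sR : Summable (fun n : ℕ => b n / n * R n) := by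
      refine (s1.add sP.summable).congr (fun n => ?_)
      ring
    rw [← sP.tsum_eq, ← sR.tsum_sub sP.summable]
    exact tsum_congr (fun n => by ring)
  rw [eS, ← mul_sub, ← eD, norm_mul, norm_mul, Real.norm_eq_abs (t ^ _),
    abs_of_pos (Real.rpow_pos_of_pos ht0 _)]
  have hb : ‖∑' n : ℕ, b n / n * (R n - P n)‖ ≤
      ∑' n : ℕ, K * t ^ (τ - 7 / 3) * (|b n| / n * (1 + Real.log n) ^ 3) := by
    refine tsum_of_norm_bounded (hs.mul_left _).hasSum (fun n => ?_)
    rw [norm_mul, norm_div, Real.norm_eq_abs, Real.norm_eq_abs, Real.norm_eq_abs, Nat.abs_cast]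
    calc |b n| / n * |R n - P n| ≤ |b n| / n * (K * t ^ (τ - 7 / 3) * (1 + Real.log n) ^ 3) := by
          have := hd n
          gcongr
      _ = _ := by ring
  rw [tsum_mul_left] at hb
  calc _ ≤ ‖Real.exp t‖ * (K * t ^ (τ - 7 / 3) * ∑' n : ℕ, |b n| / n * (1 + Real.log n) ^ 3) := by
        gcongr
    _ = _ := by ring

end Moree


namespace Moree

lemma cv_congr {a a' b b' : ℕ → ℝ} (ha : ∀ n, 1 ≤ n → a n = a' n) (hb : ∀ n, 1 ≤ n → b n = b' n)
    (n : ℕ) : cv a b n = cv a' b' n := by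
  refine Finset.sum_congr rfl (fun d hd => ?_)
  have hd0 : 0 < d := Nat.pos_of_mem_divisors hd
  have hd' := Nat.le_of_dvd (Nat.pos_of_ne_zero (Nat.ne_zero_of_mem_divisors hd))
    (Nat.dvd_of_mem_divisors hd)
  rw [ha d hd0, hb _ (Nat.div_pos hd' hd0)]

theorem main
    (f : ℕ → ℝ) (c₁ c₂ τ ρ B : ℝ)
    (hf1 : f 1 = 1)
    (hfmult : ∀ m n : ℕ, Nat.Coprime m n → f (m * n) = f m * f n)
    (hc₁ : 1 ≤ c₁) (hc₂ : 1 ≤ c₂) (hc₂' : c₂ < 2)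
    (hbound : ∀ p r : ℕ, p.Prime → 1 ≤ r → 0 ≤ f (p ^ r) ∧ f (p ^ r) ≤ c₁ * c₂ ^ r)
    (hτ : 0 < τ) (hρ : 1 < ρ)
    (hprimes : (fun x : ℝ => (∑ p ∈ (Finset.Icc 1 ⌊x⌋₊).filter Nat.Prime, f p)
        - τ * ∫ t in (2:ℝ)..x, 1 / Real.log t) =O[atTop]
        fun x : ℝ => x * Real.log x ^ (-2 - ρ))
    (Λf : ℕ → ℝ)
    (hΛf : ∀ n : ℕ, 1 ≤ n → f n * Real.log n = ∑ d ∈ n.divisors, f d * Λf (n / d))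
    (hB : Tendsto (fun x : ℝ => (∑ n ∈ Finset.Icc 1 ⌊x⌋₊, Λf n / n) - τ * Real.log x)
        atTop (𝓝 B)) :
    ∃ C > 0, (fun t => S f t - Real.exp t * (C * t ^ (τ - 1) +
      C * ((1 - τ) * (1 + B)) * t ^ (τ - 2))) =O[atTop] fun t => Real.exp t * t ^ (τ - 7 / 3) := by
  have hfp : ∀ p, p.Prime → 0 ≤ f p := fun p hp => by simpa using (hbound p 1 hp le_rfl).1
  set a : ℕ → ℝ := fun n => if n.Prime then f n else 0 with ha
  have ha0 : ∀ n, 0 ≤ a n := by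
    intro n; rw [ha]; simp only
    split_ifs with hp
    · exact hfp n hp
    · exact le_rfl
  have hA : (fun t => S a t - τ * ell t) =O[atTop] fun t => Real.exp t * t ^ (-2 - ρ) := by
    refine (hprimes.comp_tendsto Real.tendsto_exp_atTop).congr (fun t => ?_) (fun t => ?_)
    · simp only [Function.comp]
      rw [Finset.sum_filter]; rfl
    · simp only [Function.comp]
      rw [Real.log_exp]
  have hlam : ∀ n : ℕ, lam f n = a n * Real.log n := by
    intro n
    show (if n.Prime then f n * Real.log n else 0) = (if n.Prime then f n else 0) * Real.log n
    split_ifs <;> simp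
  have hpsi := prime_psi ha0 hA
  obtain ⟨Bg, hT⟩ := prime_T ha0 hρ hA
  have hyp : Hyp (E f) (lam f) τ ρ Bg :=
    { g0 := E_nonneg hfp
      l0 := fun n => by rw [hlam]; exact mul_nonneg (ha0 n) log_nonneg'
      g1 := E_one f
      D := fun n _ => by rw [E_D, mul_cv]
      tau := hτ
      rho := hρ
      psi := by
        rw [show (⇑(lam f)) = fun n : ℕ => a n * Real.log n from funext hlam]
        exact hpsi
      T := by simpa only [hlam] using hT }
  have hs := hh_moment hf1 hfmult hc₁ hc₂ hc₂' hbound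
  have hH0 := H0_pos hf1 hfmult hc₁ hc₂ hc₂' hbound
  have hm : Tendsto (fun t => S (fun n => (mk0 Λf - lam f) n / n) t) atTop (𝓝 (B - Bg)) := by
    have h1 := hB.comp Real.tendsto_exp_atTop
    have h2 : Tendsto (fun t => S (fun n => lam f n / n) t - τ * t - Bg) atTop (𝓝 0) := by
      obtain ⟨K, hK, hb⟩ := hyp.T
      have h3 : Tendsto (fun t : ℝ => K * (1 + t) ^ (-ρ)) atTop (𝓝 0) := by
        have := ((tendsto_rpow_neg_atTop (by linarith : 0 < ρ)).comp
          (tendsto_atTop_add_const_left atTop (1:ℝ) tendsto_id)).const_mul K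
        simpa using this
      refine squeeze_zero_norm' ?_ h3
      filter_upwards [eventually_ge_atTop 0] with t ht
      exact hb t ht
    have h4 := (h1.sub h2).sub_const Bg
    rw [sub_zero] at h4
    refine h4.congr (fun t => ?_)
    simp only [Function.comp]
    rw [Real.log_exp]
    have e : S (fun n => (mk0 Λf - lam f) n / n) t =
        S (fun n => Λf n / n) t - S (fun n => lam f n / n) t := by
      rw [S, S, S, ← Finset.sum_sub_distrib]
      refine Finset.sum_congr rfl (fun n hn => ?_)
      have hn1 := (Finset.mem_Icc.1 hn).1
      have : (mk0 Λf - lam f) n = Λf n - lam f n := by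
        rw [← mk0_apply Λf (show n ≠ 0 by omega), sub_eq_add_neg, ArithmeticFunction.add_apply,
          sub_eq_add_neg]
        rfl
      rw [this, sub_div]
    rw [e, S, S]; ring
  have hlink := link (h := hh f) (m := ⇑(mk0 Λf - lam f : ArithmeticFunction ℝ)) hs (fun n _ => by
    rw [← mul_cv, ← hh_D hΛf, Dl_apply]) hm
  obtain ⟨C, hC, hO⟩ := transfer hyp (b := hh f) (by simp) hs
  refine ⟨C * ∑' n : ℕ, hh f n / n, mul_pos hC hH0, ?_⟩
  refine hO.congr_left (fun t => ?_)
  rw [hlink]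
  have e : S (cv (hh f) (E f)) t = S f t := by
    refine S_congr (fun n hn => ?_) t
    rw [← mul_cv, hh_spec, mk0_apply f (by omega)]
  rw [e]; ring

end Moree

/-- **Moree, Theorem 1 (main part).** Under the hypotheses on the multiplicative
function `f` (growth bound on prime powers and
`∑_{p ≤ x} f(p) = τ Li(x) + O(x (log x)^{-2-ρ})`), with `B_f` the constant such that
`∑_{n ≤ x} Λ_f(n)/n = τ log x + B_f + o(1)`, there are `ε' > 0`, `C₁(f) > 0` and
`C₂(f)` with
`∑_{n ≤ x} f(n) = (C₁ x / (log x)^{1-τ}) (1 + C₂/log x + O((log x)^{-1-ε'}))`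
and `C₂(f) = (1-τ)(1+B_f)`. -/
theorem moree_main_theorem
    (f : ℕ → ℝ) (c₁ c₂ τ ρ B : ℝ)
    (hf1 : f 1 = 1)
    (hfmult : ∀ m n : ℕ, Nat.Coprime m n → f (m * n) = f m * f n)
    (hc₁ : 1 ≤ c₁) (hc₂ : 1 ≤ c₂) (hc₂' : c₂ < 2)
    (hbound : ∀ p r : ℕ, p.Prime → 1 ≤ r → 0 ≤ f (p ^ r) ∧ f (p ^ r) ≤ c₁ * c₂ ^ r)
    (hτ : 0 < τ) (hρ : 1 < ρ)
    (hprimes : (fun x : ℝ => (∑ p ∈ (Finset.Icc 1 ⌊x⌋₊).filter Nat.Prime, f p)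
        - τ * ∫ t in (2:ℝ)..x, 1 / Real.log t) =O[atTop]
        fun x : ℝ => x * Real.log x ^ (-2 - ρ))
    (Λf : ℕ → ℝ)
    (hΛf : ∀ n : ℕ, 1 ≤ n → f n * Real.log n = ∑ d ∈ n.divisors, f d * Λf (n / d))
    (hB : Tendsto (fun x : ℝ => (∑ n ∈ Finset.Icc 1 ⌊x⌋₊, Λf n / n) - τ * Real.log x)
        atTop (𝓝 B)) :
    ∃ ε' > (0:ℝ), ∃ C₁ > (0:ℝ), ∃ C₂ : ℝ, C₂ = (1 - τ) * (1 + B) ∧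
      (fun x : ℝ => (∑ n ∈ Finset.Icc 1 ⌊x⌋₊, f n)
          - C₁ * x / Real.log x ^ (1 - τ) * (1 + C₂ / Real.log x))
        =O[atTop] fun x : ℝ => x / Real.log x ^ (1 - τ) * Real.log x ^ (-(1 + ε')) := by
  
  obtain ⟨C, hC, hO⟩ := Moree.main f c₁ c₂ τ ρ B hf1 hfmult hc₁ hc₂ hc₂' hbound hτ hρ hprimes Λf hΛf hB
  refine ⟨1 / 3, by norm_num, C, hC, (1 - τ) * (1 + B), rfl, ?_⟩
  refine (hO.comp_tendsto Real.tendsto_log_atTop).congr' ?_ ?_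
  · filter_upwards [eventually_gt_atTop 1] with x hx
    have hL := Real.log_pos hx
    simp only [Function.comp]
    rw [Moree.S, Real.exp_log (by linarith), show τ - 1 = -(1 - τ) by ring,
      show τ - 2 = -(1 - τ) - 1 by ring, Real.rpow_sub_one hL.ne', Real.rpow_neg hL.le]
    ring
  · filter_upwards [eventually_gt_atTop 1] with x hx
    have hL := Real.log_pos hx
    simp only [Function.comp]
    rw [Real.exp_log (by linarith), div_eq_mul_inv x, ← Real.rpow_neg hL.le, mul_assoc,
      ← Real.rpow_add hL]
    congr 2; ring
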